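/- arXiv:1011.3183 — 4 statements merged into one kernel-verified Lean document; each statement's English description precedes it below -/
import Mathlib

section
/- The deficient digit set Ω^L is a closed subset of ℝ, it is contained in the interval [0, 1/3], it is a perfect set (it has no isolated points), and it has Lebesgue measure zero. -/
open MeasureTheory Set

/-- Distance from a real number to the nearest integer. -/
noncomputable def distNearestInt (t : ℝ) : ℝ := |t - round t|

/-- The Takagi function. -/
noncomputable def takagi (x : ℝ) : ℝ := ∑' n : ℕ, distNearestInt (2 ^ n * x) / 2 ^ n

/-- The `j`-th binary digit of `x ∈ [0,1)` (binary expansion terminating in `0^∞`). -/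
noncomputable def bdigit (x : ℝ) (j : ℕ) : ℤ := ⌊(2 : ℝ) ^ j * x⌋ - 2 * ⌊(2 : ℝ) ^ (j - 1) * x⌋

/-- The deficient digit function `D_j(x) = j - 2(b_1(x) + ⋯ + b_j(x))`. -/
noncomputable def defDigit (x : ℝ) (j : ℕ) : ℤ := (j : ℤ) - 2 * ∑ i ∈ Finset.Icc 1 j, bdigit x i

/-- The deficient digit set `Ω^L`. -/
noncomputable def OmegaL : Set ℝ := {x | x ∈ Set.Ico (0 : ℝ) 1 ∧ ∀ j : ℕ, 1 ≤ j → 0 ≤ defDigit x j}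

/-- The set `½Ω^L = {x ∈ [0,1) : D_j(x) > 0 for all j ≥ 1}`. -/
noncomputable def halfOmegaL : Set ℝ :=
  {x | x ∈ Set.Ico (0 : ℝ) 1 ∧ ∀ j : ℕ, 1 ≤ j → 0 < defDigit x j}

/-- The Takagi singular function. -/
noncomputable def takagiS (x : ℝ) : ℝ := sSup {y | ∃ t ∈ OmegaL, t ≤ x ∧ y = takagi t + t}

/-- `Ω^L_∞`: points of `Ω^L` with infinitely many balance points. -/
noncomputable def OmegaLinf : Set ℝ :=
  {x ∈ OmegaL | {j : ℕ | 1 ≤ j ∧ defDigit x j = 0}.Infinite}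

/-- `Ω^L_fin = Ω^L \ Ω^L_∞`. -/
noncomputable def OmegaLfin : Set ℝ := OmegaL \ OmegaLinf

/-- `(m, k)` encodes a member `k / 2^(2m)` of the breakpoint set `ℬ'`. -/
noncomputable def breakpoint (m k : ℕ) : Prop :=
  (m = 0 ∧ k = 0) ∨
    (1 ≤ m ∧ 0 < k ∧ k < 2 ^ (2 * m) ∧
      (∀ j : ℕ, 1 ≤ j → j ≤ 2 * m - 1 → 0 ≤ defDigit ((k : ℝ) / 2 ^ (2 * m)) j) ∧
      defDigit ((k : ℝ) / 2 ^ (2 * m)) (2 * m) = 0)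

/-- The fine partition set `Ω^L(B)` for `B = k / 2^(2m)`. -/
noncomputable def fineSet (m k : ℕ) : Set ℝ :=
  {x | ∃ x' ∈ halfOmegaL, x = (k : ℝ) / 2 ^ (2 * m) + x' / 2 ^ (2 * m)}

/-- The set `Γ_{2r}`. -/
noncomputable def Gamma (r : ℕ) : Set ℝ :=
  {x | x ∈ Set.Ico (0 : ℝ) 1 ∧ ∀ j : ℕ, 1 ≤ j →
    ((¬ (2 * r ∣ j) → 0 < defDigit x j) ∧ ((2 * r) ∣ j → defDigit x j = 0))}

/-- The level set `L(y)` of the Takagi function. -/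
noncomputable def levelSet (y : ℝ) : Set ℝ := {x ∈ Set.Icc (0 : ℝ) 1 | takagi x = y}

lemma dd_zero (x : ℝ) : defDigit x 0 = 0 := by simp [defDigit]

lemma dd_succ (x : ℝ) (j : ℕ) :
    defDigit x (j+1) = defDigit x j + 1 - 2 * bdigit x (j+1) := by
  unfold defDigit
  rw [Finset.sum_Icc_succ_top (by omega)]
  push_cast
  ring

lemma bd_succ (x : ℝ) (j : ℕ) :
    bdigit x (j+1) = ⌊(2:ℝ)^(j+1) * x⌋ - 2 * ⌊(2:ℝ)^j * x⌋ := by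
  simp [bdigit]

lemma bd_cases (x : ℝ) (j : ℕ) :
    (bdigit x (j+1) = 0 ∧ Int.fract ((2:ℝ)^(j+1) * x) = 2 * Int.fract ((2:ℝ)^j * x)) ∨
    (bdigit x (j+1) = 1 ∧ Int.fract ((2:ℝ)^(j+1) * x) = 2 * Int.fract ((2:ℝ)^j * x) - 1) := by
  have e : (2:ℝ)^(j+1) * x = 2 * ((2:ℝ)^j * x) := by ring
  rw [bd_succ, e]
  generalize (2:ℝ)^j * x = t
  have h0 := Int.floor_le t
  have h1 := Int.lt_floor_add_one t
  unfold Int.fract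
  by_cases h : t < ⌊t⌋ + 1/2
  · left
    have : ⌊2 * t⌋ = 2 * ⌊t⌋ := by
      rw [Int.floor_eq_iff]; push_cast; constructor <;> linarith
    rw [this]; push_cast; constructor
    · ring
    · ring
  · right
    have : ⌊2 * t⌋ = 2 * ⌊t⌋ + 1 := by
      rw [Int.floor_eq_iff]; push_cast; constructor <;> linarith
    rw [this]; push_cast; constructor
    · ring
    · ring

lemma bd_shift (x : ℝ) (n k : ℕ) :
    bdigit (Int.fract ((2:ℝ)^n * x)) (k+1) = bdigit x (n+k+1) := by
  rw [bd_succ, bd_succ]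
  have H : ∀ k : ℕ, ⌊(2:ℝ)^k * Int.fract ((2:ℝ)^n * x)⌋
      = ⌊(2:ℝ)^(n+k) * x⌋ - 2^k * ⌊(2:ℝ)^n * x⌋ := by
    intro k
    rw [← Int.floor_sub_intCast]
    congr 1
    unfold Int.fract
    push_cast
    ring
  rw [H, H, ← add_assoc]
  ring

lemma dd_add (x : ℝ) (n k : ℕ) :
    defDigit x (n+k) = defDigit x n + defDigit (Int.fract ((2:ℝ)^n * x)) k := by
  induction k with
  | zero => simp [dd_zero]
  | succ k ih => rw [← add_assoc, dd_succ, dd_succ, ih, bd_shift]; ring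

lemma dd_le (x : ℝ) (j : ℕ) : defDigit x j ≤ j := by
  induction j with
  | zero => simp [dd_zero]
  | succ k ih =>
    rw [dd_succ]
    rcases bd_cases x k with h | h <;> rw [h.1] <;> push_cast <;> linarith

lemma dd_nonneg {x : ℝ} (hx : x ∈ OmegaL) (j : ℕ) : 0 ≤ defDigit x j := by
  rcases Nat.eq_zero_or_pos j with rfl | h
  · simp [dd_zero]
  · exact hx.2 j h

noncomputable def gaux (x : ℝ) (j : ℕ) : ℝ :=
  2/3 * (2:ℝ)^(-defDigit x j) - (1 - Int.fract ((2:ℝ)^j * x))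

lemma gaux_succ {x : ℝ} (hx : x ∈ OmegaL) (j : ℕ) : 2 * gaux x j ≤ gaux x (j+1) := by
  unfold gaux
  have h2 : (2:ℝ)^(-defDigit x j) ≤ 1 :=
    zpow_le_one_of_nonpos₀ (by norm_num) (by have := dd_nonneg hx j; omega)
  rw [dd_succ]
  rcases bd_cases x j with h | h <;> rw [h.1, h.2]
  · have : (2:ℝ)^(-(defDigit x j + 1 - 2 * 0)) = (2:ℝ)^(-defDigit x j) / 2 := by
      rw [show -(defDigit x j + 1 - 2 * 0) = -defDigit x j - 1 by ring,
        zpow_sub_one₀ (by norm_num)]; ring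
    rw [this]; linarith
  · have : (2:ℝ)^(-(defDigit x j + 1 - 2 * 1)) = (2:ℝ)^(-defDigit x j) * 2 := by
      rw [show -(defDigit x j + 1 - 2 * 1) = -defDigit x j + 1 by ring,
        zpow_add_one₀ (by norm_num)]
    rw [this]; linarith

lemma gaux_le {x : ℝ} (hx : x ∈ OmegaL) (j : ℕ) : gaux x j ≤ 1 := by
  unfold gaux
  have h2 : (2:ℝ)^(-defDigit x j) ≤ 1 :=
    zpow_le_one_of_nonpos₀ (by norm_num) (by have := dd_nonneg hx j; omega)
  have := Int.fract_lt_one ((2:ℝ)^j * x)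
  linarith

lemma gaux_nonpos {x : ℝ} (hx : x ∈ OmegaL) (j : ℕ) : gaux x j ≤ 0 := by
  by_contra! h
  have H : ∀ k : ℕ, 2^k * gaux x j ≤ gaux x (j+k) := by
    intro k
    induction k with
    | zero => simp
    | succ k ih =>
      have := gaux_succ hx (j+k)
      rw [pow_succ, ← add_assoc]; linarith
  obtain ⟨k, hk⟩ := pow_unbounded_of_one_lt (1 / gaux x j) (one_lt_two (α := ℝ))
  rw [div_lt_iff₀ h] at hk
  have := H k
  have := gaux_le hx (j+k)
  linarith

lemma fract_bound {x : ℝ} (hx : x ∈ OmegaL) (j : ℕ) :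
    Int.fract ((2:ℝ)^j * x) ≤ 1 - 2/3 * (2:ℝ)^(-(j:ℤ)) := by
  have h := gaux_nonpos hx j
  unfold gaux at h
  have : (2:ℝ)^(-(j:ℤ)) ≤ (2:ℝ)^(-defDigit x j) :=
    zpow_le_zpow_right₀ (by norm_num) (by have := dd_le x j; omega)
  linarith

lemma omega_sub : OmegaL ⊆ Set.Icc (0:ℝ) (1/3) := by
  intro x hx
  have h := fract_bound hx 0
  have : Int.fract x = x := Int.fract_eq_self.2 hx.1
  norm_num [this] at h
  exact ⟨hx.1.1, by linarith⟩

lemma dd_congr {x y : ℝ} (j : ℕ) (h : ∀ i ≤ j, ⌊(2:ℝ)^i * y⌋ = ⌊(2:ℝ)^i * x⌋) :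
    defDigit y j = defDigit x j := by
  unfold defDigit
  congr 2
  apply Finset.sum_congr rfl
  intro i hi
  have := (Finset.mem_Icc.1 hi).2
  unfold bdigit
  rw [h i this, h (i-1) (by omega)]

lemma floor_ev (x : ℝ) (j : ℕ) :
    ∀ᶠ y in nhds x, y ∈ OmegaL → ⌊(2:ℝ)^j * y⌋ = ⌊(2:ℝ)^j * x⌋ := by
  have hc : Filter.Tendsto (fun y : ℝ => (2:ℝ)^j * y) (nhds x) (nhds ((2:ℝ)^j * x)) :=
    (continuous_const.mul continuous_id).tendsto x
  have hp : (0:ℝ) < (2:ℝ)^(-(j:ℤ)) := by positivity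
  have hp1 : (2:ℝ)^(-(j:ℤ)) ≤ 1 := zpow_le_one_of_nonpos₀ (by norm_num) (by omega)
  have h0 := Int.floor_le ((2:ℝ)^j * x)
  have h1 := Int.lt_floor_add_one ((2:ℝ)^j * x)
  filter_upwards [hc.eventually_lt_const h1,
    hc.eventually_const_lt (u := (⌊(2:ℝ)^j * x⌋ : ℝ) - 2/3 * (2:ℝ)^(-(j:ℤ))) (by linarith)]
    with y hy1 hy2 hy
  have hf := fract_bound hy j
  rw [Int.floor_eq_iff]
  refine ⟨?_, hy1⟩
  by_contra! hlt
  have : ⌊(2:ℝ)^j * y⌋ = ⌊(2:ℝ)^j * x⌋ - 1 := by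
    rw [Int.floor_eq_iff]; push_cast; constructor <;> linarith
  unfold Int.fract at hf
  rw [this] at hf
  push_cast at hf
  linarith

lemma omega_closed : IsClosed OmegaL := by
  rw [isClosed_iff_frequently]
  intro x hx
  have hI : x ∈ Set.Icc (0:ℝ) (1/3) :=
    (isClosed_Icc (a := (0:ℝ)) (b := 1/3)).closure_subset_iff.2 omega_sub
      (mem_closure_iff_frequently.2 hx)
  refine ⟨⟨hI.1, by linarith [hI.2]⟩, fun j _ => ?_⟩
  have he : ∀ᶠ y in nhds x, ∀ i ∈ Finset.range (j+1),
      y ∈ OmegaL → ⌊(2:ℝ)^i * y⌋ = ⌊(2:ℝ)^i * x⌋ := by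
    rw [Filter.eventually_all_finset]
    exact fun i _ => floor_ev x i
  obtain ⟨y, hy, hy'⟩ := (hx.and_eventually he).exists
  rw [← dd_congr (x := x) (y := y) j (fun i hi => hy' i (Finset.mem_range.2 (by omega)) hy)]
  exact dd_nonneg hy j

lemma omega_ext {x c : ℝ} (hx : x ∈ OmegaL) (hc : c ∈ OmegaL) (n : ℕ) :
    (⌊(2:ℝ)^n * x⌋ + c) / 2^n ∈ OmegaL := by
  set y := (⌊(2:ℝ)^n * x⌋ + c) / 2^n with hy
  have hny : (2:ℝ)^n * y = ⌊(2:ℝ)^n * x⌋ + c := by rw [hy]; field_simp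
  have hfc : Int.fract c = c := Int.fract_eq_self.2 hc.1
  have hflc : ⌊c⌋ = 0 := Int.floor_eq_zero_iff.2 hc.1
  have hfl : ∀ i ≤ n, ⌊(2:ℝ)^i * y⌋ = ⌊(2:ℝ)^i * x⌋ := by
    intro i hi
    have H : ∀ z : ℝ, ⌊(2:ℝ)^i * z⌋ = ⌊(2:ℝ)^n * z⌋ / ((2^(n-i) : ℕ) : ℤ) := by
      intro z
      rw [← Int.floor_div_natCast]
      congr 1
      push_cast
      rw [eq_div_iff (by positivity), mul_right_comm, ← pow_add]
      congr 2; omega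
    rw [H, H, hny, Int.floor_intCast_add, hflc, add_zero]
  have hfr : Int.fract ((2:ℝ)^n * y) = c := by rw [hny, Int.fract_intCast_add, hfc]
  refine ⟨?_, fun j _ => ?_⟩
  · have := hfl 0 (by omega)
    simp only [pow_zero, one_mul] at this
    rw [Int.floor_eq_zero_iff.2 hx.1] at this
    exact Int.floor_eq_zero_iff.1 this
  · rcases le_total j n with h | h
    · rw [dd_congr j (fun i hi => hfl i (hi.trans h))]
      exact dd_nonneg hx j
    · obtain ⟨k, rfl⟩ := Nat.exists_eq_add_of_le h
      rw [dd_add, hfr, dd_congr n hfl]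
      exact add_nonneg (dd_nonneg hx n) (dd_nonneg hc k)

lemma dd_of_zero (k : ℕ) : defDigit 0 k = k := by
  simp [defDigit, bdigit]

lemma zero_mem_omega : (0:ℝ) ∈ OmegaL := by
  refine ⟨by simp, fun j _ => ?_⟩
  rw [dd_of_zero]; positivity

lemma quarter_mem_omega : (1/4:ℝ) ∈ OmegaL := by
  refine ⟨by constructor <;> norm_num, fun j hj => ?_⟩
  have h1 : defDigit (1/4) 1 = 1 := by
    rw [show 1 = 0 + 1 from rfl, dd_succ, dd_zero, bd_succ]; norm_num
  have h2 : defDigit (1/4) 2 = 0 := by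
    have a := dd_succ (1/4) 1
    rw [h1, bd_succ] at a
    norm_num at a
    exact a
  rcases Nat.lt_or_ge j 2 with h | h
  · have : j = 1 := by omega
    rw [this, h1]; norm_num
  · obtain ⟨k, rfl⟩ := Nat.exists_eq_add_of_le h
    rw [dd_add, h2]; norm_num [dd_of_zero]

lemma omega_perfect : Preperfect OmegaL := by
  intro x hx
  rw [accPt_iff_nhds]
  intro U hU
  obtain ⟨ε, hε, hU⟩ := Metric.mem_nhds_iff.1 hU
  obtain ⟨n, hn⟩ := exists_pow_lt_of_lt_one hε (show (1/2:ℝ) < 1 by norm_num)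
  have key : ∀ c : ℝ, c ∈ OmegaL → (⌊(2:ℝ)^n * x⌋ + c) / 2^n ∈ U ∩ OmegaL := by
    intro c hc
    refine ⟨hU ?_, omega_ext hx hc n⟩
    rw [Metric.mem_ball, Real.dist_eq]
    refine lt_of_le_of_lt ?_ hn
    have : (⌊(2:ℝ)^n * x⌋ + c) / 2^n - x = (c - Int.fract ((2:ℝ)^n * x)) * (1/2)^n := by
      unfold Int.fract
      rw [one_div, inv_pow]
      field_simp
      ring
    rw [this, abs_mul, abs_of_pos (show (0:ℝ) < (1/2)^n by positivity)]
    apply mul_le_of_le_one_left (by positivity)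
    have a := Int.fract_nonneg ((2:ℝ)^n * x)
    have b := Int.fract_lt_one ((2:ℝ)^n * x)
    have := hc.1.1
    have := hc.1.2
    rw [abs_le]; constructor <;> linarith
  by_cases h : (⌊(2:ℝ)^n * x⌋ + (0:ℝ)) / 2^n = x
  · refine ⟨_, key _ quarter_mem_omega, fun h' => ?_⟩
    have := h.trans h'.symm
    rw [div_left_inj' (by positivity)] at this
    norm_num at this
  · exact ⟨_, key _ zero_mem_omega, h⟩

/-- Walk started at `e` stays positive. -/
noncomputable def Om (e : ℕ) : Set ℝ := {x | x ∈ Set.Ico (0:ℝ) 1 ∧ ∀ j, 0 < defDigit x j + e}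

lemma bd_meas (j : ℕ) : Measurable fun x => bdigit x j := by
  unfold bdigit
  fun_prop

lemma dd_meas (j : ℕ) : Measurable fun x => defDigit x j := by
  unfold defDigit
  have := bd_meas
  fun_prop

lemma om_meas (e : ℕ) : MeasurableSet (Om e) := by
  have : Om e = Set.Ico (0:ℝ) 1 ∩ ⋂ j, {x | 0 < defDigit x j + e} := by
    ext x; simp [Om]
  rw [this]
  refine measurableSet_Ico.inter (MeasurableSet.iInter fun j => ?_)
  exact measurableSet_lt measurable_const ((dd_meas j).add_const _)

lemma om_rec (e : ℕ) : Om (e+1) = (fun x => 2 * x) ⁻¹' (Om (e+2)) ∪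
    (fun x => 2 * x) ⁻¹' ((fun x => x + (-1)) ⁻¹' (Om e)) := by
  ext x
  have hd : ∀ k, defDigit x (1+k) = 1 - 2 * bdigit x 1 + defDigit (Int.fract (2*x)) k := by
    intro k
    have a := dd_succ x 0
    rw [dd_zero, zero_add, zero_add] at a
    rw [dd_add, pow_one, a]
  have hb : bdigit x 1 = ⌊2*x⌋ - 2 * ⌊x⌋ := by simp [bdigit]
  have hz := dd_zero x
  simp only [Om, Set.mem_union, Set.mem_preimage, Set.mem_setOf_eq, Set.mem_Ico]
  constructor
  · rintro ⟨⟨h0, h1⟩, h⟩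
    have hx : ⌊x⌋ = 0 := Int.floor_eq_zero_iff.2 ⟨h0, h1⟩
    by_cases hh : x < 1/2
    · left
      have h2 : ⌊2*x⌋ = 0 := Int.floor_eq_zero_iff.2 ⟨by linarith, by linarith⟩
      have hf : Int.fract (2*x) = 2*x := by simp [Int.fract, h2]
      refine ⟨⟨by linarith, by linarith⟩, fun j => ?_⟩
      have a := h (1+j)
      rw [hd, hb, hx, h2, hf] at a
      push_cast at a ⊢; linarith
    · right
      have h2 : ⌊2*x⌋ = 1 := by rw [Int.floor_eq_iff]; push_cast; constructor <;> linarith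
      have hf : Int.fract (2*x) = 2*x + -1 := by simp [Int.fract, h2]; ring
      refine ⟨⟨by linarith, by linarith⟩, fun j => ?_⟩
      have a := h (1+j)
      rw [hd, hb, hx, h2, hf] at a
      push_cast at a ⊢; linarith
  · rintro (⟨⟨h0, h1⟩, h⟩ | ⟨⟨h0, h1⟩, h⟩)
    · have hx : ⌊x⌋ = 0 := Int.floor_eq_zero_iff.2 ⟨by linarith, by linarith⟩
      have h2 : ⌊2*x⌋ = 0 := Int.floor_eq_zero_iff.2 ⟨by linarith, by linarith⟩
      have hf : Int.fract (2*x) = 2*x := by simp [Int.fract, h2]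
      refine ⟨⟨by linarith, by linarith⟩, fun j => ?_⟩
      rcases j with _ | j
      · rw [hz]; push_cast; positivity
      · have a := h j
        rw [add_comm j 1, hd, hb, hx, h2, hf]
        push_cast at a ⊢; linarith
    · have hx : ⌊x⌋ = 0 := Int.floor_eq_zero_iff.2 ⟨by linarith, by linarith⟩
      have h2 : ⌊2*x⌋ = 1 := by rw [Int.floor_eq_iff]; push_cast; constructor <;> linarith
      have hf : Int.fract (2*x) = 2*x + -1 := by simp [Int.fract, h2]; ring
      refine ⟨⟨by linarith, by linarith⟩, fun j => ?_⟩
      rcases j with _ | j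
      · rw [hz]; push_cast; positivity
      · have a := h j
        rw [add_comm j 1, hd, hb, hx, h2, hf]
        push_cast at a ⊢; linarith

lemma om_le (e : ℕ) : volume (Om e) ≤ 1 := by
  calc volume (Om e) ≤ volume (Set.Ico (0:ℝ) 1) := measure_mono fun x hx => hx.1
    _ = 1 := by simp

lemma om_fin (e : ℕ) : volume (Om e) ≠ ⊤ := ((om_le e).trans_lt ENNReal.one_lt_top).ne

lemma om_vol (e : ℕ) : (volume (Om (e+1))).toReal =
    ((volume (Om (e+2))).toReal + (volume (Om e)).toReal) / 2 := by
  rw [om_rec, measure_union]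
  · rw [Real.volume_preimage_mul_left (by norm_num), Real.volume_preimage_mul_left (by norm_num),
      measure_preimage_add_right, ← mul_add, ENNReal.toReal_mul,
      ENNReal.toReal_add (om_fin _) (om_fin _), ENNReal.toReal_ofReal (abs_nonneg _)]
    rw [abs_of_pos (by norm_num)]
    ring
  · rw [Set.disjoint_left]
    rintro x ⟨⟨_, h1⟩, _⟩ ⟨⟨h2, _⟩, _⟩
    linarith
  · have := om_meas e
    exact (measurable_const_mul (2:ℝ)) ((measurable_add_const (-1:ℝ)) this)

lemma om_zero : Om 0 = ∅ := by
  ext x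
  simp only [Om, Set.mem_setOf_eq, Set.mem_empty_iff_false, iff_false]
  rintro ⟨_, h⟩
  have := h 0
  simp [dd_zero] at this

lemma om_lin (e : ℕ) : (volume (Om e)).toReal = e * (volume (Om 1)).toReal ∧
    (volume (Om (e+1))).toReal = (e+1) * (volume (Om 1)).toReal := by
  induction e with
  | zero => simp [om_zero]
  | succ e ih =>
    refine ⟨by push_cast; exact ih.2, ?_⟩
    have := om_vol e
    push_cast
    rw [show e + 1 + 1 = e + 2 from rfl]
    linarith [ih.1, ih.2]

lemma om_one : volume (Om 1) = 0 := by
  by_contra h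
  have hp : 0 < (volume (Om 1)).toReal := ENNReal.toReal_pos h (om_fin 1)
  obtain ⟨n, hn⟩ := exists_nat_gt (1 / (volume (Om 1)).toReal)
  rw [div_lt_iff₀ hp, ← (om_lin n).1] at hn
  have := ENNReal.toReal_mono ENNReal.one_ne_top (om_le n)
  simp at this
  linarith

/-- Properties of the deficient digit set `Ω^L`. -/
theorem omegaL_closed_subset_perfect_measure_zero :
    IsClosed OmegaL ∧ OmegaL ⊆ Set.Icc (0 : ℝ) (1 / 3) ∧ Perfect OmegaL ∧
      MeasureTheory.volume OmegaL = 0 := by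
  refine ⟨omega_closed, omega_sub, ⟨omega_closed, omega_perfect⟩, ?_⟩
  refine measure_mono_null (fun x hx => ?_) om_one
  refine ⟨hx.1, fun j => ?_⟩
  have := dd_nonneg hx j
  push_cast
  linarith
end

section
/- The Takagi singular function τ^S is a monotone singular function on [0,1]: it is nondecreasing and continuous on [0,1], it satisfies τ^S(0) = 0 and τ^S(1) = 1, and it has derivative equal to zero at Lebesgue-almost every point of [0,1]. -/
open MeasureTheory Set

namespace TakS

theorem dni_cont : Continuous distNearestInt := by
  have : distNearestInt = fun x : ℝ => ‖(x : UnitAddCircle)‖ := by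
    funext x; rw [UnitAddCircle.norm_eq]; rfl
  rw [this]
  exact continuous_norm.comp (AddCircle.continuous_mk' 1)

theorem dni_nonneg (t : ℝ) : 0 ≤ distNearestInt t := abs_nonneg _

theorem dni_le (t : ℝ) : distNearestInt t ≤ 1 / 2 := abs_sub_round t

theorem dni_add_int (t : ℝ) (m : ℤ) : distNearestInt (t + m) = distNearestInt t := by
  unfold distNearestInt
  rw [round_add_intCast]; push_cast; congr 1; ring

theorem dni_lo {t : ℝ} (h0 : 0 ≤ t) (h1 : t < 1 / 2) : distNearestInt t = t := by
  have : round t = 0 := by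
    rw [round_eq, Int.floor_eq_zero_iff]; constructor <;> linarith
  unfold distNearestInt; rw [this]; simp [abs_of_nonneg h0]

theorem dni_hi {t : ℝ} (h0 : 1 / 2 ≤ t) (h1 : t < 1) : distNearestInt t = 1 - t := by
  have : round t = 1 := by
    rw [round_eq, Int.floor_eq_iff]; constructor <;> push_cast <;> linarith
  unfold distNearestInt; rw [this, abs_of_nonpos] <;> push_cast <;> linarith

theorem term_bound (x : ℝ) (n : ℕ) : ‖distNearestInt (2 ^ n * x) / 2 ^ n‖ ≤ (1 / 2) ^ n := by
  rw [Real.norm_eq_abs, abs_of_nonneg (div_nonneg (dni_nonneg _) (by positivity)), one_div, inv_pow,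
    div_eq_mul_inv]
  have := dni_le (2 ^ n * x)
  have h2 : (0 : ℝ) < (2 ^ n)⁻¹ := by positivity
  nlinarith

theorem tsummable (x : ℝ) : Summable fun n : ℕ => distNearestInt (2 ^ n * x) / 2 ^ n :=
  Summable.of_norm_bounded summable_geometric_two (term_bound x)

theorem takagi_cont : Continuous takagi := by
  refine continuous_tsum (fun n => ?_) summable_geometric_two (fun n x => term_bound x n)
  exact (dni_cont.comp (by fun_prop)).div_const _

theorem takagi_nonneg (x : ℝ) : 0 ≤ takagi x :=
  tsum_nonneg fun _ => div_nonneg (dni_nonneg _) (by positivity)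

theorem takagi_le (x : ℝ) : takagi x ≤ 2 := by
  rw [← tsum_geometric_two]
  exact (tsummable x).tsum_le_tsum (fun n => (le_abs_self _).trans (term_bound x n))
    summable_geometric_two

theorem takagi_rec (x : ℝ) : takagi x = distNearestInt x + takagi (2 * x) / 2 := by
  unfold takagi
  rw [(tsummable x).tsum_eq_zero_add, ← tsum_div_const]
  congr 1
  · simp
  · congr 1; funext n
    rw [pow_succ, div_div]; congr 2; ring

theorem takagi_sub_one (x : ℝ) : takagi (x - 1) = takagi x := by
  unfold takagi
  congr 1; funext n
  congr 1
  rw [← dni_add_int (2 ^ n * (x - 1)) (2 ^ n)]; push_cast; congr 1; ring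

theorem takagi_lo {x : ℝ} (h0 : 0 ≤ x) (h1 : x < 1 / 2) : takagi x = x + takagi (2 * x) / 2 := by
  rw [takagi_rec, dni_lo h0 h1]

theorem takagi_hi {x : ℝ} (h0 : 1 / 2 ≤ x) (h1 : x < 1) :
    takagi x = 1 - x + takagi (2 * x - 1) / 2 := by
  rw [takagi_rec, dni_hi h0 h1, takagi_sub_one]

theorem takagi_zero : takagi 0 = 0 := by
  have := takagi_lo (x := 0) le_rfl (by norm_num)
  simp at this; linarith

theorem takagi_half : takagi (1 / 2) = 1 / 2 := by
  have := takagi_hi (x := 1 / 2) le_rfl (by norm_num)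
  norm_num [takagi_zero] at this ⊢; linarith

theorem takagi_third : takagi (1 / 3) = 2 / 3 := by
  have h1 := takagi_lo (x := 1 / 3) (by norm_num) (by norm_num)
  have h2 := takagi_hi (x := 2 * (1 / 3)) (by norm_num) (by norm_num)
  have : (2 * (2 * (1 / 3)) - 1 : ℝ) = 1 / 3 := by norm_num
  rw [this] at h2
  linarith

/-! Digits -/

theorem dd_zero (x : ℝ) : defDigit x 0 = 0 := by simp [defDigit]

theorem dd_succ (x : ℝ) (j : ℕ) : defDigit x (j + 1) = defDigit x j + 1 - 2 * bdigit x (j + 1) := by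
  unfold defDigit
  rw [Finset.sum_Icc_succ_top (by omega)]; push_cast; ring

theorem bd_two (x : ℝ) (j : ℕ) : bdigit (2 * x) (j + 1) = bdigit x (j + 2) := by
  unfold bdigit
  simp only [Nat.add_sub_cancel, show j + 2 - 1 = j + 1 from rfl]
  rw [show (2 : ℝ) ^ (j + 1) * (2 * x) = 2 ^ (j + 2) * x by ring,
    show (2 : ℝ) ^ j * (2 * x) = 2 ^ (j + 1) * x by ring]

theorem bd_sub (x : ℝ) (j : ℕ) : bdigit (x - 1) (j + 1) = bdigit x (j + 1) := by
  unfold bdigit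
  simp only [Nat.add_sub_cancel]
  rw [show (2 : ℝ) ^ (j + 1) * (x - 1) = 2 ^ (j + 1) * x - ((2 ^ (j + 1) : ℤ) : ℝ) by push_cast; ring,
    show (2 : ℝ) ^ j * (x - 1) = 2 ^ j * x - ((2 ^ j : ℤ) : ℝ) by push_cast; ring,
    Int.floor_sub_intCast, Int.floor_sub_intCast]
  ring

theorem dd_sub (x : ℝ) (j : ℕ) : defDigit (x - 1) j = defDigit x j := by
  induction j with
  | zero => simp [dd_zero]
  | succ j ih => rw [dd_succ, dd_succ, ih, bd_sub]

theorem dd_two (x : ℝ) (j : ℕ) :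
    defDigit x (j + 1) = defDigit (2 * x) j + 1 - 2 * bdigit x 1 := by
  induction j with
  | zero => rw [dd_succ, dd_zero, dd_zero]
  | succ j ih => rw [dd_succ, ih, dd_succ, bd_two]; ring

theorem dd_lo {x : ℝ} (h0 : 0 ≤ x) (h1 : x < 1 / 2) (j : ℕ) :
    defDigit x (j + 1) = defDigit (2 * x) j + 1 := by
  have a : ⌊x⌋ = 0 := by rw [Int.floor_eq_zero_iff]; constructor <;> linarith
  have b : ⌊2 * x⌋ = 0 := by rw [Int.floor_eq_zero_iff]; constructor <;> linarith
  rw [dd_two]; simp [bdigit, a, b]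

theorem dd_hi {x : ℝ} (h0 : 1 / 2 ≤ x) (h1 : x < 1) (j : ℕ) :
    defDigit x (j + 1) = defDigit (2 * x - 1) j - 1 := by
  have a : ⌊x⌋ = 0 := by rw [Int.floor_eq_zero_iff]; constructor <;> linarith
  have b : ⌊2 * x⌋ = 1 := by rw [Int.floor_eq_iff]; constructor <;> push_cast <;> linarith
  rw [dd_two, dd_sub]; simp [bdigit, a, b]; ring

def S (c : ℤ) : Set ℝ := {x | x ∈ Set.Ico (0 : ℝ) 1 ∧ ∀ j : ℕ, 0 ≤ c + defDigit x j}

theorem S_zero : S 0 = OmegaL := by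
  ext x
  simp only [S, OmegaL, Set.mem_ofPred_eq, zero_add]
  refine and_congr_right fun _ => ⟨fun h j _ => h j, fun h j => ?_⟩
  rcases Nat.eq_zero_or_pos j with rfl | hj
  · rw [dd_zero]
  · exact h j hj

theorem S_nonneg {c : ℤ} {x : ℝ} (h : x ∈ S c) : 0 ≤ c := by
  have := h.2 0; rwa [dd_zero, add_zero] at this

theorem S_lo {c : ℤ} {x : ℝ} (h1 : x < 1 / 2) :
    x ∈ S c ↔ 0 ≤ c ∧ 2 * x ∈ S (c + 1) := by
  constructor
  · intro h
    refine ⟨S_nonneg h, ⟨by linarith [h.1.1], by linarith⟩, fun j => ?_⟩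
    have := h.2 (j + 1); rw [dd_lo h.1.1 h1] at this; linarith
  · rintro ⟨hc, h⟩
    have h0 : 0 ≤ x := by linarith [h.1.1]
    refine ⟨⟨h0, by linarith⟩, fun j => ?_⟩
    cases j with
    | zero => rw [dd_zero]; simpa
    | succ j => rw [dd_lo h0 h1]; have := h.2 j; linarith

theorem S_hi {c : ℤ} {x : ℝ} (h1 : 1 / 2 ≤ x) :
    x ∈ S c ↔ 2 * x - 1 ∈ S (c - 1) := by
  constructor
  · intro h
    refine ⟨⟨by linarith, by linarith [h.1.2]⟩, fun j => ?_⟩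
    have := h.2 (j + 1); rw [dd_hi h1 h.1.2] at this; linarith
  · intro h
    have hx : x < 1 := by linarith [h.1.2]
    refine ⟨⟨by linarith, hx⟩, fun j => ?_⟩
    cases j with
    | zero => rw [dd_zero]; have := S_nonneg h; omega
    | succ j => rw [dd_hi h1 hx]; have := h.2 j; linarith

theorem zero_mem {c : ℤ} (hc : 0 ≤ c) : (0 : ℝ) ∈ S c := by
  refine ⟨by norm_num, fun j => ?_⟩
  have : defDigit 0 j = j := by simp [defDigit, bdigit]
  omega

theorem third_mem : (1 / 3 : ℝ) ∈ S 0 := by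
  refine ⟨by norm_num, ?_⟩
  have key : ∀ j, defDigit (1 / 3) (j + 2) = defDigit (1 / 3) j := by
    intro j
    rw [dd_lo (by norm_num) (by norm_num), dd_hi (by norm_num) (by norm_num)]
    norm_num
  have : ∀ j, 0 ≤ defDigit (1 / 3) j ∧ 0 ≤ defDigit (1 / 3) (j + 1) := by
    intro j
    induction j with
    | zero =>
      rw [dd_lo (by norm_num) (by norm_num), dd_zero, dd_zero]; norm_num
    | succ j ih => exact ⟨ih.2, by rw [key]; exact ih.1⟩
  intro j; simpa using (this j).1

/-- the weighted function -/
noncomputable def g (c : ℤ) (x : ℝ) : ℝ := takagi x + (c + 1) * x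

theorem g_lo {c : ℤ} {x : ℝ} (h0 : 0 ≤ x) (h1 : x < 1 / 2) : g c x = g (c + 1) (2 * x) / 2 := by
  unfold g; rw [takagi_lo h0 h1]; push_cast; ring

theorem g_hi {c : ℤ} {x : ℝ} (h0 : 1 / 2 ≤ x) (h1 : x < 1) :
    g c x = (c + 2 + g (c - 1) (2 * x - 1)) / 2 := by
  unfold g; rw [takagi_hi h0 h1]; push_cast; ring

theorem exists_max (k : ℕ) : ∃ w ∈ S k, g k w = k + 1 := by
  induction k with
  | zero => exact ⟨1 / 3, third_mem, by unfold g; rw [takagi_third]; norm_num⟩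
  | succ k ih =>
    obtain ⟨w, hw, hg⟩ := ih
    have h0 := hw.1.1
    have h1 := hw.1.2
    have e : 2 * ((1 + w) / 2) - 1 = w := by ring
    refine ⟨(1 + w) / 2, ?_, ?_⟩
    · rw [S_hi (by linarith), e]; simpa using hw
    · rw [g_hi (by linarith) (by linarith), e]; push_cast
      rw [show ((k : ℤ) + 1 - 1) = k by ring, hg]; ring

theorem g_le_aux (n : ℕ) : ∀ (c : ℤ) (x : ℝ), x ∈ S c → g c x ≤ c + 1 + 2 / 2 ^ n := by
  induction n with
  | zero =>
    intro c x hx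
    have h1 := takagi_le x
    have h2 : (0 : ℝ) ≤ c := by exact_mod_cast S_nonneg hx
    have := hx.1.2
    unfold g; norm_num; nlinarith
  | succ n ih =>
    intro c x hx
    have h2 : (0 : ℝ) ≤ c := by exact_mod_cast S_nonneg hx
    have e : (2 : ℝ) / 2 ^ (n + 1) = (2 / 2 ^ n) / 2 := by rw [pow_succ]; field_simp
    rw [e]
    rcases lt_or_ge x (1 / 2) with h | h
    · have := ih _ _ ((S_lo h).1 hx).2
      rw [g_lo hx.1.1 h]; push_cast at this; linarith
    · have := ih _ _ ((S_hi h).1 hx)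
      rw [g_hi h hx.1.2]; push_cast at this; linarith

theorem g_le {x : ℝ} (hx : x ∈ S 0) : takagi x + x ≤ 1 := by
  have h : ∀ n : ℕ, takagi x + x ≤ 1 + 2 * (1 / 2) ^ n := by
    intro n
    have := g_le_aux n 0 x hx
    unfold g at this
    rw [one_div, inv_pow, ← div_eq_mul_inv]
    simpa using this
  have l : Filter.Tendsto (fun n : ℕ => (1 : ℝ) + 2 * (1 / 2) ^ n) Filter.atTop (nhds (1 + 2 * 0)) :=
    ((tendsto_pow_atTop_nhds_zero_of_lt_one (by norm_num) (by norm_num)).const_mul 2).const_add 1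
  have := ge_of_tendsto' l h
  linarith

theorem approx (n : ℕ) : ∀ (c : ℤ) (x : ℝ), x ∈ S c → 0 < x →
    ∃ a ∈ S c, a < x ∧ g c x - (c + n + 3) / 2 ^ n ≤ g c a := by
  induction n with
  | zero =>
    intro c x hx h0
    have hc := S_nonneg hx
    have hc' : (0 : ℝ) ≤ c := by exact_mod_cast hc
    refine ⟨0, zero_mem hc, h0, ?_⟩
    have h1 := takagi_le x
    have := hx.1.2
    simp only [g, takagi_zero]; norm_num; nlinarith
  | succ n ih =>
    intro c x hx h0
    have hc := S_nonneg hx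
    have hc' : (0 : ℝ) ≤ c := by exact_mod_cast hc
    have e (y : ℝ) : y / 2 ^ (n + 1) = (y / 2 ^ n) / 2 := by rw [pow_succ]; field_simp
    rw [e]
    rcases lt_trichotomy x (1 / 2) with h | h | h
    · obtain ⟨a, ha, hax, hg⟩ := ih _ _ ((S_lo h).1 hx).2 (by linarith)
      have e2 : 2 * (a / 2) = a := by ring
      have := ha.1.1
      refine ⟨a / 2, ?_, by linarith, ?_⟩
      · rw [S_lo (by linarith), e2]; exact ⟨hc, ha⟩
      · rw [g_lo hx.1.1 h, g_lo (x := a / 2) (by linarith) (by linarith), e2]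
        push_cast at hg ⊢
        rw [show (c : ℝ) + (n + 1) + 3 = c + 1 + n + 3 by ring]
        linarith
    · subst h
      obtain ⟨k, rfl⟩ := Int.eq_ofNat_of_zero_le hc
      obtain ⟨w, hw, hg⟩ := exists_max (k + 1)
      have := hw.1.1
      have := hw.1.2
      have e2 : 2 * (w / 2) = w := by ring
      refine ⟨w / 2, ?_, by linarith, ?_⟩
      · rw [S_lo (by linarith), e2]; exact ⟨hc, by exact_mod_cast hw⟩
      · rw [g_lo (x := w / 2) (by linarith) (by linarith), e2]
        have e3 : g ((k : ℤ) + 1) w = k + 1 + 1 := by exact_mod_cast hg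
        rw [e3]
        unfold g
        rw [takagi_half]
        have : (0 : ℝ) ≤ (((k : ℤ) : ℝ) + ((n + 1 : ℕ) : ℝ) + 3) / 2 ^ n / 2 := by positivity
        push_cast at *
        linarith
    · obtain ⟨a, ha, hax, hg⟩ := ih _ _ ((S_hi h.le).1 hx) (by linarith)
      have e2 : 2 * ((1 + a) / 2) - 1 = a := by ring
      have := ha.1.1
      have := ha.1.2
      refine ⟨(1 + a) / 2, ?_, by linarith, ?_⟩
      · rw [S_hi (by linarith), e2]; exact ha
      · rw [g_hi h.le hx.1.2, g_hi (x := (1 + a) / 2) (by linarith) (by linarith), e2]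
        push_cast at hg ⊢
        have : ((c : ℝ) - 1 + n + 3) / 2 ^ n ≤ (c + (n + 1) + 3) / 2 ^ n := by
          gcongr <;> linarith
        linarith

theorem approx_eps {x : ℝ} (hx : x ∈ S 0) (h0 : 0 < x) {ε : ℝ} (hε : 0 < ε) :
    ∃ a ∈ S 0, a < x ∧ takagi x + x - ε ≤ takagi a + a := by
  have l : Filter.Tendsto (fun n : ℕ => ((n : ℝ) ^ 1 * (1 / 2) ^ n + 3 * (1 / 2) ^ n))
      Filter.atTop (nhds (0 + 3 * 0)) :=
    (tendsto_pow_const_mul_const_pow_of_abs_lt_one 1 (by rw [abs_of_pos] <;> norm_num)).add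
    ((tendsto_pow_atTop_nhds_zero_of_lt_one (by norm_num) (by norm_num)).const_mul 3)
  obtain ⟨n, hn⟩ := (l.eventually (gt_mem_nhds (show (0 + 3 * 0 : ℝ) < ε by simpa))).exists
  obtain ⟨a, ha, hax, hg⟩ := approx n 0 x hx h0
  refine ⟨a, ha, hax, ?_⟩
  unfold g at hg
  have : (((0 : ℤ) : ℝ) + n + 3) / 2 ^ n = (n : ℝ) ^ 1 * (1 / 2) ^ n + 3 * (1 / 2) ^ n := by
    rw [one_div, inv_pow]; push_cast; field_simp; ring
  rw [this] at hg
  push_cast at hg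
  linarith

/-! Closedness -/

theorem S_bound (k : ℕ) : ∀ z ∈ S k, z ≤ 1 - (1 / 2) ^ (k + 1) := by
  induction k with
  | zero =>
    intro z hz
    by_contra! h
    have h2 : (1 : ℝ) / 2 ≤ z := by norm_num at h; linarith
    have := S_nonneg ((S_hi h2).1 hz)
    norm_num at this
  | succ k ih =>
    intro z hz
    rcases lt_or_ge z (1 / 2) with h | h
    · have : (1 / 2 : ℝ) ^ (k + 1 + 1) ≤ (1 / 2) ^ 1 :=
        pow_le_pow_of_le_one (by norm_num) (by norm_num) (by omega)
      linarith
    · have := ih (2 * z - 1) (by simpa using (S_hi h).1 hz)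
      rw [pow_succ]; linarith

theorem near_one (c : ℤ) : ∀ᶠ z in nhds (1 : ℝ), z ∉ S c := by
  rcases lt_or_ge c 0 with h | h
  · exact Filter.Eventually.of_forall fun z hz => absurd (S_nonneg hz) (by omega)
  · obtain ⟨k, rfl⟩ := Int.eq_ofNat_of_zero_le h
    have : (1 : ℝ) - (1 / 2) ^ (k + 1) < 1 := by simp
    filter_upwards [lt_mem_nhds this] with z hz hm
    exact absurd (S_bound k z hm) (not_le.2 hz)

theorem isolated (j : ℕ) : ∀ (c : ℤ) (x : ℝ), 0 ≤ x → x < 1 → c + defDigit x j < 0 →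
    ∀ᶠ y in nhds x, y ∉ S c := by
  induction j with
  | zero =>
    intro c x _ _ h
    rw [dd_zero] at h
    exact Filter.Eventually.of_forall fun z hz => absurd (S_nonneg hz) (by omega)
  | succ j ih =>
    intro c x h0 h1 h
    have t1 : Filter.Tendsto (fun y : ℝ => 2 * y) (nhds x) (nhds (2 * x)) :=
      Continuous.tendsto (by fun_prop) x
    have t2 : Filter.Tendsto (fun y : ℝ => 2 * y - 1) (nhds x) (nhds (2 * x - 1)) :=
      Continuous.tendsto (by fun_prop) x
    rcases lt_or_ge x (1 / 2) with hx | hx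
    · rw [dd_lo h0 hx] at h
      have := t1.eventually (ih (c + 1) (2 * x) (by linarith) (by linarith) (by linarith))
      filter_upwards [this, gt_mem_nhds hx] with y hy hy2 hm
      exact hy ((S_lo hy2).1 hm).2
    · rw [dd_hi hx h1] at h
      have a := t2.eventually (ih (c - 1) (2 * x - 1) (by linarith) (by linarith) (by linarith))
      have b : ∀ᶠ y in nhds x, y < 1 / 2 → y ∉ S c := by
        rcases hx.eq_or_lt with rfl | hx'
        · have e : (2 : ℝ) * (1 / 2) = 1 := by norm_num
          rw [e] at t1
          filter_upwards [t1.eventually (near_one (c + 1))] with y hy hy2 hm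
          exact hy ((S_lo hy2).1 hm).2
        · filter_upwards [lt_mem_nhds hx'] with y hy hy2
          linarith
      filter_upwards [a, b] with y ha hb hm
      rcases lt_or_ge y (1 / 2) with hy | hy
      · exact hb hy hm
      · exact ha ((S_hi hy).1 hm)

theorem S_closed (c : ℤ) : IsClosed (S c) := by
  rw [← isOpen_compl_iff, isOpen_iff_mem_nhds]
  intro x hx
  change ∀ᶠ y in nhds x, y ∉ S c
  rcases lt_or_ge x 0 with h0 | h0
  · filter_upwards [gt_mem_nhds h0] with y hy hm
    exact absurd hm.1.1 (not_le.2 hy)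
  rcases lt_trichotomy x 1 with h1 | rfl | h1
  · have : ∃ j, c + defDigit x j < 0 := by
      by_contra! h
      exact hx ⟨⟨h0, h1⟩, h⟩
    obtain ⟨j, hj⟩ := this
    exact isolated j c x h0 h1 hj
  · exact near_one c
  · filter_upwards [lt_mem_nhds h1] with y hy hm
    exact absurd hm.1.2 (not_lt.2 hy.le)

/-! Measure -/

noncomputable def p (c : ℤ) : ℝ := (volume (S c)).toReal

theorem S_sub (c : ℤ) : S c ⊆ Set.Icc 0 1 := fun _ h => ⟨h.1.1, h.1.2.le⟩

theorem vol_le (c : ℤ) : volume (S c) ≤ 1 := by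
  calc _ ≤ volume (Set.Icc (0 : ℝ) 1) := measure_mono (S_sub c)
    _ = 1 := by simp

theorem vol_ne (c : ℤ) : volume (S c) ≠ ⊤ := ((vol_le c).trans_lt (by simp)).ne

theorem p_le (c : ℤ) : p c ≤ 1 := by
  have := ENNReal.toReal_mono (by simp) (vol_le c)
  simpa [p] using this

theorem p_neg : p (-1) = 0 := by
  have : S (-1) = ∅ := by
    ext x; simp only [Set.mem_empty_iff_false, iff_false]
    intro h; exact absurd (S_nonneg h) (by norm_num)
  simp [p, this]

theorem p_rec {c : ℤ} (hc : 0 ≤ c) : p c = (p (c + 1) + p (c - 1)) / 2 := by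
  have e : S c = (fun x : ℝ => 2 * x) ⁻¹' S (c + 1) ∪
      (fun x : ℝ => 2 * x) ⁻¹' ((fun x : ℝ => x - 1) ⁻¹' S (c - 1)) := by
    ext x
    simp only [Set.mem_union, Set.mem_preimage]
    rcases lt_or_ge x (1 / 2) with h | h
    · rw [S_lo h]
      constructor
      · exact fun h => Or.inl h.2
      · rintro (h' | h')
        · exact ⟨hc, h'⟩
        · have := h'.1.1; linarith
    · rw [S_hi h]
      constructor
      · exact Or.inr
      · rintro (h' | h')
        · have := h'.1.2; linarith
        · exact h'
  have d : Disjoint ((fun x : ℝ => 2 * x) ⁻¹' S (c + 1))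
      ((fun x : ℝ => 2 * x) ⁻¹' ((fun x : ℝ => x - 1) ⁻¹' S (c - 1))) := by
    rw [Set.disjoint_left]
    intro x h1 h2
    have := h1.1.2
    have := h2.1.1
    simp only at *
    linarith
  have m : MeasurableSet ((fun x : ℝ => 2 * x) ⁻¹' ((fun x : ℝ => x - 1) ⁻¹' S (c - 1))) :=
    (((S_closed (c - 1)).preimage (by fun_prop)).preimage (by fun_prop)).measurableSet
  have v : volume (S c) = ENNReal.ofReal |(2 : ℝ)⁻¹| * volume (S (c + 1)) +
      ENNReal.ofReal |(2 : ℝ)⁻¹| * volume (S (c - 1)) := by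
    rw [e, measure_union d m, Real.volume_preimage_mul_left (by norm_num),
      Real.volume_preimage_mul_left (by norm_num)]
    simp only [sub_eq_add_neg]
    rw [measure_preimage_add_right]
  unfold p
  rw [v, ENNReal.toReal_add (ENNReal.mul_ne_top (by simp) (vol_ne _))
    (ENNReal.mul_ne_top (by simp) (vol_ne _)), ENNReal.toReal_mul, ENNReal.toReal_mul,
    ENNReal.toReal_ofReal (abs_nonneg _), abs_of_pos (by norm_num)]
  ring

theorem p_lin (n : ℕ) : p n = (n + 1) * p 0 ∧ p (n - 1) = n * p 0 := by
  induction n with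
  | zero => simp [p_neg]
  | succ n ih =>
    have := p_rec (c := n) (by omega)
    have e : (((n + 1 : ℕ) : ℤ) - 1) = n := by push_cast; ring
    rw [e]
    push_cast
    refine ⟨?_, ih.1⟩
    linarith [ih.1, ih.2]

theorem p_zero : p 0 = 0 := by
  by_contra h
  have hp : 0 < p 0 := lt_of_le_of_ne ENNReal.toReal_nonneg (Ne.symm h)
  obtain ⟨n, hn⟩ := exists_nat_gt (1 / p 0)
  have h1 := (p_lin n).1
  have h2 := p_le n
  rw [div_lt_iff₀ hp] at hn
  linarith

theorem vol_zero : volume (S 0) = 0 := by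
  have := p_zero
  unfold p at this
  rw [ENNReal.toReal_eq_zero_iff] at this
  exact this.resolve_right (vol_ne 0)

/-! The singular function -/

theorem bdd (x : ℝ) : BddAbove {y | ∃ t ∈ OmegaL, t ≤ x ∧ y = takagi t + t} := by
  refine ⟨1, ?_⟩
  rintro y ⟨t, ht, -, rfl⟩
  exact g_le (S_zero ▸ ht)

theorem le_F {t x : ℝ} (ht : t ∈ S 0) (h : t ≤ x) : takagi t + t ≤ takagiS x :=
  le_csSup (bdd x) ⟨t, S_zero ▸ ht, h, rfl⟩

theorem F_le {x M : ℝ} (hx : 0 ≤ x) (h : ∀ t ∈ S 0, t ≤ x → takagi t + t ≤ M) :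
    takagiS x ≤ M := by
  refine csSup_le ⟨_, 0, S_zero ▸ zero_mem le_rfl, hx, rfl⟩ ?_
  rintro y ⟨t, ht, htx, rfl⟩
  exact h t (S_zero ▸ ht) htx

theorem F_mono {x y : ℝ} (hx : 0 ≤ x) (h : x ≤ y) : takagiS x ≤ takagiS y :=
  F_le hx fun _ ht htx => le_F ht (htx.trans h)

theorem F_const {x : ℝ} (hx : x ∉ S 0) : takagiS =ᶠ[nhds x] fun _ => takagiS x := by
  have := (S_closed 0).isOpen_compl.mem_nhds hx
  obtain ⟨δ, hδ, hb⟩ := Metric.mem_nhds_iff.1 this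
  filter_upwards [Metric.ball_mem_nhds x hδ] with y hy
  unfold takagiS
  congr 1
  ext z
  rw [Real.ball_eq_Ioo] at hb hy
  constructor
  · rintro ⟨t, ht, h, rfl⟩
    refine ⟨t, ht, ?_, rfl⟩
    by_contra! hl
    exact hb ⟨by linarith, by linarith [hy.2]⟩ (S_zero ▸ ht)
  · rintro ⟨t, ht, h, rfl⟩
    refine ⟨t, ht, ?_, rfl⟩
    by_contra! hl
    exact hb ⟨by linarith [hy.1], by linarith⟩ (S_zero ▸ ht)

theorem F_cont : ContinuousOn takagiS (Set.Icc (0 : ℝ) 1) := by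
  intro x hx
  by_cases hm : x ∈ S 0
  swap
  · exact ((continuousAt_const).congr (F_const hm).symm).continuousWithinAt
  rw [Metric.continuousWithinAt_iff]
  intro ε hε
  have gc : Continuous fun t => takagi t + t := takagi_cont.add continuous_id
  obtain ⟨δ, hδ, hc⟩ := Metric.continuousAt_iff.1 (gc.continuousAt (x := x)) (ε / 3) (by linarith)
  have hc' : ∀ t, |t - x| < δ → takagi t + t < takagi x + x + ε / 3 := by
    intro t ht
    have := hc (by rwa [Real.dist_eq])
    rw [Real.dist_eq] at this
    linarith [(abs_lt.1 this).2]
  have low : ∃ a ∈ S 0, takagi x + x - ε / 3 ≤ takagi a + a ∧ (a < x ∨ x = 0 ∧ a = 0) := by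
    rcases hx.1.eq_or_lt with rfl | h0
    · exact ⟨0, hm, by linarith, Or.inr ⟨rfl, rfl⟩⟩
    · obtain ⟨a, ha, hax, hg⟩ := approx_eps hm h0 (show 0 < ε / 3 by linarith)
      exact ⟨a, ha, hg, Or.inl hax⟩
  obtain ⟨a, ha, hg, hax⟩ := low
  have : ∃ η > 0, ∀ y ∈ Set.Icc (0 : ℝ) 1, |y - x| < η → a ≤ y := by
    rcases hax with h | ⟨h, h'⟩
    · refine ⟨x - a, by linarith, fun y _ hy => ?_⟩
      linarith [(abs_lt.1 hy).1]
    · exact ⟨1, one_pos, fun y hy _ => h' ▸ hy.1⟩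
  obtain ⟨η, hη, hay⟩ := this
  refine ⟨min δ η, lt_min hδ hη, fun y hy hd => ?_⟩
  rw [Real.dist_eq] at hd ⊢
  have d1 := abs_lt.1 (hd.trans_le (min_le_left _ _))
  have hay := hay y hy (hd.trans_le (min_le_right _ _))
  have up : takagiS y ≤ takagiS x + ε / 3 := by
    refine F_le hy.1 fun t ht hty => ?_
    rcases le_or_gt t x with h | h
    · linarith [le_F ht h]
    · have := hc' t (abs_lt.2 ⟨by linarith, by linarith⟩)
      linarith [le_F hm le_rfl]
  have lo : takagiS x ≤ takagiS y + 2 * (ε / 3) := by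
    refine F_le hx.1 fun t ht htx => ?_
    rcases le_or_gt t y with h | h
    · linarith [le_F ht h]
    · have := hc' t (abs_lt.2 ⟨by linarith, by linarith⟩)
      linarith [le_F ha hay]
  rw [abs_lt]; constructor <;> linarith

end TakS

/-- The Takagi singular function is a monotone singular function on `[0,1]`. -/
theorem takagiS_monotone_singular :
    MonotoneOn takagiS (Set.Icc (0 : ℝ) 1) ∧ ContinuousOn takagiS (Set.Icc (0 : ℝ) 1) ∧
      takagiS 0 = 0 ∧ takagiS 1 = 1 ∧
      ∀ᵐ x ∂(MeasureTheory.volume.restrict (Set.Icc (0 : ℝ) 1)), HasDerivAt takagiS 0 x := by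
  refine ⟨fun x hx y _ h => TakS.F_mono hx.1 h, TakS.F_cont, ?_, ?_, ?_⟩
  · apply le_antisymm
    · refine TakS.F_le le_rfl fun t ht h => ?_
      have : t = 0 := le_antisymm h ht.1.1
      rw [this, TakS.takagi_zero]; simp
    · have := TakS.le_F (TakS.zero_mem le_rfl) (le_refl 0)
      rwa [TakS.takagi_zero, add_zero] at this
  · apply le_antisymm
    · exact TakS.F_le zero_le_one fun t ht _ => TakS.g_le ht
    · have := TakS.le_F (x := 1) TakS.third_mem (by norm_num)
      rw [TakS.takagi_third] at this; linarith
  · apply ae_restrict_of_ae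
    have : ∀ᵐ x ∂(volume : Measure ℝ), x ∉ TakS.S 0 := measure_eq_zero_iff_ae_notMem.1 TakS.vol_zero
    filter_upwards [this] with x hx
    exact (hasDerivAt_const x _).congr_of_eventuallyEq (TakS.F_const hx)
end

section
/- For each element B = k/2^{2m} of the breakpoint set ℬ' (a balanced dyadic rational in the deficient digit set, with B = 0 corresponding to m = 0), the Takagi singular measure of the fine partition set Ω^L(B) equals μ_S(Ω^L(B)) = 2^{-(2m+1)}. -/
open MeasureTheory Set

/-! Part 1: distance to the nearest integer and the Takagi function -/

theorem dni_cont : Continuous distNearestInt := by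
  have : distNearestInt = fun x : ℝ => ‖(x : UnitAddCircle)‖ := by
    funext x
    rw [UnitAddCircle.norm_eq]; rfl
  rw [this]
  exact continuous_norm.comp (AddCircle.continuous_mk' 1)

theorem dni_nonneg (x : ℝ) : 0 ≤ distNearestInt x := abs_nonneg _

theorem dni_le (x : ℝ) : distNearestInt x ≤ 1 := by
  have := abs_sub_round x
  unfold distNearestInt
  linarith

theorem dni_left (q : ℤ) (t : ℝ) (h1 : (q : ℝ) ≤ t) (h2 : t ≤ q + 1 / 2) :
    distNearestInt t = t - q := by
  have hf : ⌊t⌋ = q := by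
    rw [Int.floor_eq_iff]; constructor <;> linarith
  have hfr : Int.fract t = t - q := by rw [Int.fract, hf]
  unfold distNearestInt
  rw [abs_sub_round_eq_min, hfr]
  apply min_eq_left; linarith

theorem dni_right (q : ℤ) (t : ℝ) (h1 : (q : ℝ) + 1 / 2 ≤ t) (h2 : t ≤ q + 1) :
    distNearestInt t = q + 1 - t := by
  rcases h2.lt_or_eq with h | h
  · have hf : ⌊t⌋ = q := by
      rw [Int.floor_eq_iff]; constructor <;> linarith
    have hfr : Int.fract t = t - q := by rw [Int.fract, hf]
    unfold distNearestInt
    rw [abs_sub_round_eq_min, hfr, min_eq_right (by linarith)]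
    ring
  · rw [dni_left (q + 1) t (by push_cast; linarith) (by push_cast; linarith)]
    push_cast; linarith

theorem dni_mid (n i : ℕ) :
    distNearestInt ((2 * i + 1 : ℝ) / 2 ^ (n + 2)) =
      (distNearestInt ((i : ℝ) / 2 ^ (n + 1)) + distNearestInt ((i + 1 : ℝ) / 2 ^ (n + 1))) / 2 := by
  have hp : (0 : ℝ) < 2 ^ n := by positivity
  set m := i / 2 ^ n with hm
  have a1 : m * 2 ^ n ≤ i := Nat.div_mul_le_self _ _
  have a2 : i + 1 ≤ (m + 1) * 2 ^ n := by
    have h := Nat.lt_div_mul_add (a := i) (show 0 < 2 ^ n by positivity)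
    rw [← hm] at h
    rw [add_mul, one_mul]; exact h
  have b1 : (m : ℝ) * 2 ^ n ≤ i := by exact_mod_cast a1
  have b2 : (i : ℝ) + 1 ≤ (m + 1) * 2 ^ n := by exact_mod_cast a2
  have c1 : (m : ℝ) / 2 ≤ (i : ℝ) / 2 ^ (n + 1) := by
    rw [div_le_div_iff₀ (by norm_num) (by positivity), pow_succ]; nlinarith
  have c2 : ((i : ℝ) + 1) / 2 ^ (n + 1) ≤ (m + 1) / 2 := by
    rw [div_le_div_iff₀ (by positivity) (by norm_num), pow_succ]; nlinarith
  have e : (2 * i + 1 : ℝ) / 2 ^ (n + 2) = ((i : ℝ) / 2 ^ (n + 1) + (i + 1 : ℝ) / 2 ^ (n + 1)) / 2 := by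
    field_simp; ring
  have c3 : (i : ℝ) / 2 ^ (n + 1) ≤ ((i : ℝ) + 1) / 2 ^ (n + 1) := by gcongr; linarith
  rw [e]
  generalize (i : ℝ) / 2 ^ (n + 1) = u at *
  generalize ((i : ℝ) + 1) / 2 ^ (n + 1) = v at *
  rcases Nat.even_or_odd' m with ⟨q, hq | hq⟩
  · have hq' : (m : ℝ) = 2 * q := by exact_mod_cast hq
    rw [dni_left q, dni_left q, dni_left q] <;> push_cast <;> linarith
  · have hq' : (m : ℝ) = 2 * q + 1 := by exact_mod_cast hq
    rw [dni_right q, dni_right q, dni_right q] <;> push_cast <;> linarith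

theorem tak_bound (x : ℝ) (n : ℕ) : ‖distNearestInt (2 ^ n * x) / 2 ^ n‖ ≤ (1 / 2 : ℝ) ^ n := by
  rw [Real.norm_of_nonneg (div_nonneg (dni_nonneg _) (by positivity)), div_pow, one_pow]
  gcongr
  exact dni_le _

theorem tak_summable (x : ℝ) : Summable fun n : ℕ => distNearestInt (2 ^ n * x) / 2 ^ n :=
  Summable.of_norm_bounded summable_geometric_two (tak_bound x)

theorem tak_cont : Continuous takagi := by
  unfold takagi
  refine continuous_tsum (fun n => ?_) summable_geometric_two (fun n x => tak_bound x n)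
  exact (dni_cont.comp (continuous_const.mul continuous_id)).div_const _

theorem tak_func (x : ℝ) : takagi x = distNearestInt x + takagi (2 * x) / 2 := by
  unfold takagi
  rw [(tak_summable x).tsum_eq_zero_add, ← tsum_div_const]
  congr 1
  · simp
  · congr 1; funext n
    rw [pow_succ, mul_assoc]
    field_simp

theorem dni_nat (q : ℕ) : distNearestInt (q : ℝ) = 0 := by
  rw [dni_left q] <;> simp

theorem tak_nat (q : ℕ) : takagi (q : ℝ) = 0 := by
  unfold takagi
  have : (fun n : ℕ => distNearestInt (2 ^ n * (q : ℝ)) / 2 ^ n) = fun _ => 0 := by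
    funext n
    have : (2 : ℝ) ^ n * q = ((2 ^ n * q : ℕ) : ℝ) := by push_cast; ring
    rw [this, dni_nat, zero_div]
  rw [this, tsum_zero]

theorem tak_mid (n : ℕ) : ∀ i : ℕ, takagi ((2 * i + 1 : ℝ) / 2 ^ (n + 1)) =
    (takagi ((i : ℝ) / 2 ^ n) + takagi ((i + 1 : ℝ) / 2 ^ n)) / 2 + 1 / 2 ^ (n + 1) := by
  induction n with
  | zero =>
    intro i
    have h1 : takagi ((i : ℝ) + 1) = 0 := by exact_mod_cast tak_nat (i + 1)
    have h2 : takagi (2 * ((2 * i + 1 : ℝ) / 2 ^ (0 + 1))) = 0 := by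
      have : 2 * ((2 * i + 1 : ℝ) / 2 ^ (0 + 1)) = ((2 * i + 1 : ℕ) : ℝ) := by
        push_cast; ring
      rw [this, tak_nat]
    rw [tak_func, h2, dni_left i]
    · simp [tak_nat, h1]; ring
    · push_cast; linarith
    · push_cast; linarith
  | succ n ih =>
    intro i
    have e1 : 2 * ((2 * i + 1 : ℝ) / 2 ^ (n + 1 + 1)) = (2 * i + 1 : ℝ) / 2 ^ (n + 1) := by
      rw [pow_succ _ (n + 1)]; field_simp
    have e2 : 2 * ((i : ℝ) / 2 ^ (n + 1)) = (i : ℝ) / 2 ^ n := by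
      rw [pow_succ _ n]; field_simp
    have e3 : 2 * ((i + 1 : ℝ) / 2 ^ (n + 1)) = (i + 1 : ℝ) / 2 ^ n := by
      rw [pow_succ _ n]; field_simp
    rw [tak_func, tak_func ((i : ℝ) / 2 ^ (n + 1)), tak_func ((i + 1 : ℝ) / 2 ^ (n + 1)),
      e1, e2, e3, ih, dni_mid]
    rw [pow_succ _ (n + 1)]
    field_simp
    ring

/-! Part 2: digits -/

def dd : ℕ → ℕ → ℤ
  | 0, _ => 0
  | n + 1, i => dd n (i / 2) + 1 - 2 * ((i % 2 : ℕ) : ℤ)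

def adm : ℕ → ℕ → Prop
  | 0, i => i = 0
  | n + 1, i => adm n (i / 2) ∧ 0 ≤ dd (n + 1) i

theorem dd_even (n i : ℕ) : dd (n + 1) (2 * i) = dd n i + 1 := by
  simp [dd]

theorem dd_odd (n i : ℕ) : dd (n + 1) (2 * i + 1) = dd n i - 1 := by
  have h1 : (2 * i + 1) / 2 = i := by omega
  have h2 : (2 * i + 1) % 2 = 1 := by omega
  simp only [dd, h1, h2]; push_cast; ring

theorem adm_even (n i : ℕ) : adm (n + 1) (2 * i) ↔ adm n i ∧ 0 ≤ dd n i + 1 := by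
  rw [adm, dd_even]; simp

theorem adm_odd (n i : ℕ) : adm (n + 1) (2 * i + 1) ↔ adm n i ∧ 0 ≤ dd n i - 1 := by
  have h1 : (2 * i + 1) / 2 = i := by omega
  rw [adm, dd_odd, h1]

theorem adm_nonneg (n i : ℕ) (h : adm n i) : 0 ≤ dd n i := by
  cases n with
  | zero => simp [dd]
  | succ n => exact h.2

theorem dd_le_s9 (n : ℕ) : ∀ i, dd n i ≤ n := by
  induction n with
  | zero => intro i; simp [dd]
  | succ n ih =>
    intro i
    have := ih (i / 2)
    simp only [dd]; push_cast; omega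

open Classical in
noncomputable def ww (n i : ℕ) : ℤ := if adm n i then dd n i + 1 else 0

theorem ww_nonneg (n i : ℕ) : 0 ≤ ww n i := by
  unfold ww
  split_ifs with h
  · have := adm_nonneg n i h; omega
  · rfl

theorem ww_le (n i : ℕ) : ww n i ≤ n + 1 := by
  unfold ww
  split_ifs with h
  · have := dd_le_s9 n i; omega
  · omega

theorem ww_split (n i : ℕ) : ww (n + 1) (2 * i) + ww (n + 1) (2 * i + 1) = 2 * ww n i := by
  unfold ww
  rw [adm_even, adm_odd, dd_even, dd_odd]
  by_cases h : adm n i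
  · have := adm_nonneg n i h
    simp only [h, true_and, if_true]
    split_ifs <;> omega
  · simp [h]

noncomputable def FF (n j : ℕ) : ℝ := (∑ i ∈ Finset.range j, (ww n i : ℝ)) / 2 ^ n

theorem FF_zero (n : ℕ) : FF n 0 = 0 := by simp [FF]

theorem FF_succ (n j : ℕ) : FF n (j + 1) = FF n j + ww n j / 2 ^ n := by
  simp [FF, Finset.sum_range_succ, add_div]

theorem FF_mono (n : ℕ) : Monotone (FF n) := by
  apply monotone_nat_of_le_succ
  intro j
  rw [FF_succ]
  have : (0 : ℝ) ≤ ww n j := by exact_mod_cast ww_nonneg n j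
  have : (0 : ℝ) ≤ ww n j / 2 ^ n := by positivity
  linarith

theorem FF_double (n j : ℕ) : FF (n + 1) (2 * j) = FF n j := by
  induction j with
  | zero => simp [FF_zero]
  | succ j ih =>
    rw [show 2 * (j + 1) = 2 * j + 1 + 1 by ring, FF_succ, FF_succ, FF_succ, ih]
    have := ww_split n j
    have h : (ww (n + 1) (2 * j) : ℝ) + ww (n + 1) (2 * j + 1) = 2 * ww n j := by exact_mod_cast this
    rw [add_assoc, ← add_div, h, pow_succ]
    field_simp

theorem FF_pow (n j p : ℕ) : FF (n + p) (2 ^ p * j) = FF n j := by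
  induction p with
  | zero => simp
  | succ p ih =>
    rw [pow_succ', mul_assoc, ← add_assoc, FF_double, ih]

theorem tak_diff (n : ℕ) : ∀ i : ℕ,
    takagi ((i + 1 : ℝ) / 2 ^ n) - takagi ((i : ℝ) / 2 ^ n) = dd n i / 2 ^ n := by
  induction n with
  | zero =>
    intro i
    have h1 : takagi ((i : ℝ) + 1) = 0 := by exact_mod_cast tak_nat (i + 1)
    simp [dd, h1, tak_nat]
  | succ n ih =>
    intro i
    rcases Nat.even_or_odd' i with ⟨q, rfl | rfl⟩
    · rw [dd_even]
      have h := ih q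
      have m := tak_mid n q
      have e : (((2 * q : ℕ) : ℝ)) / 2 ^ (n + 1) = (q : ℝ) / 2 ^ n := by
        push_cast; rw [pow_succ]; field_simp
      rw [e]
      push_cast
      rw [m]
      have : ((dd n q : ℝ) + 1) / 2 ^ (n + 1) = (dd n q / 2 ^ n) / 2 + 1 / 2 ^ (n + 1) := by
        rw [pow_succ]; field_simp
      rw [this]; linarith
    · rw [dd_odd]
      have h := ih q
      have m := tak_mid n q
      have e : (((2 * q + 1 : ℕ) : ℝ) + 1) / 2 ^ (n + 1) = (q + 1 : ℝ) / 2 ^ n := by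
        push_cast; rw [pow_succ]; field_simp; ring
      rw [e]
      push_cast
      rw [m]
      have : ((dd n q : ℝ) - 1) / 2 ^ (n + 1) = (dd n q / 2 ^ n) / 2 - 1 / 2 ^ (n + 1) := by
        rw [pow_succ]; field_simp
      rw [this]; linarith

noncomputable def gg (x : ℝ) : ℝ := takagi x + x

theorem gg_adm (n : ℕ) : ∀ i : ℕ, adm n i → gg ((i : ℝ) / 2 ^ n) = FF n i := by
  induction n with
  | zero =>
    intro i h
    have h : i = 0 := h
    subst h
    have := tak_nat 0
    simp only [Nat.cast_zero] at this
    simp [gg, FF, this]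
  | succ n ih =>
    intro i h
    rcases Nat.even_or_odd' i with ⟨q, rfl | rfl⟩
    · rw [adm_even] at h
      rw [FF_double, ← ih q h.1]
      congr 1
      push_cast; rw [pow_succ]; field_simp
    · rw [adm_odd] at h
      have hq := ih q h.1
      have hd := tak_diff (n + 1) (2 * q)
      have e : (((2 * q : ℕ) : ℝ)) / 2 ^ (n + 1) = (q : ℝ) / 2 ^ n := by
        push_cast; rw [pow_succ]; field_simp
      rw [FF_succ, FF_double, ← hq]
      have hw : ww (n + 1) (2 * q) = dd n q + 2 := by
        have : adm (n + 1) (2 * q) := by rw [adm_even]; exact ⟨h.1, by omega⟩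
        simp only [ww, this, if_true, dd_even]; ring
      rw [hw]
      rw [e, dd_even] at hd
      unfold gg
      push_cast at hd ⊢
      have e1 : (2 * (q : ℝ) + 1) / 2 ^ (n + 1) = q / 2 ^ n + 1 / 2 ^ (n + 1) := by
        rw [pow_succ]; field_simp
      have e2 : ((dd n q : ℝ) + 2) / 2 ^ (n + 1) = ((dd n q : ℝ) + 1) / 2 ^ (n + 1) + 1 / 2 ^ (n + 1) := by
        ring
      rw [e2, ← hd]
      linarith

/-! Part 3: cylinders -/

def Cyl (n i : ℕ) : Set ℝ := Set.Ico ((i : ℝ) / 2 ^ n) (((i : ℝ) + 1) / 2 ^ n)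

theorem mem_Cyl (n i : ℕ) (x : ℝ) : x ∈ Cyl n i ↔ ⌊(2 : ℝ) ^ n * x⌋ = (i : ℤ) := by
  unfold Cyl
  have hp : (0 : ℝ) < 2 ^ n := by positivity
  rw [Int.floor_eq_iff, Set.mem_Ico, div_le_iff₀ hp, lt_div_iff₀ hp, mul_comm x]
  push_cast; rfl

theorem Cyl_half (n i : ℕ) (x : ℝ) (h : x ∈ Cyl (n + 1) i) : x ∈ Cyl n (i / 2) := by
  rw [mem_Cyl, Int.floor_eq_iff] at *
  obtain ⟨h1, h2⟩ := h
  rw [pow_succ] at h1 h2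
  have a : 2 * (i / 2) ≤ i := by omega
  have b : i + 1 ≤ 2 * (i / 2) + 2 := by omega
  have a' : 2 * ((i / 2 : ℕ) : ℝ) ≤ i := by exact_mod_cast a
  have b' : (i : ℝ) + 1 ≤ 2 * ((i / 2 : ℕ) : ℝ) + 2 := by exact_mod_cast b
  rw [Int.cast_natCast] at *
  constructor <;> linarith

theorem Cyl_split (n i : ℕ) (x : ℝ) (h : x ∈ Cyl n i) :
    x ∈ Cyl (n + 1) (2 * i) ∨ x ∈ Cyl (n + 1) (2 * i + 1) := by
  simp only [mem_Cyl, Int.floor_eq_iff] at *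
  obtain ⟨h1, h2⟩ := h
  simp only [pow_succ]
  push_cast at *
  by_cases h : 2 ^ n * 2 * x < 2 * i + 1
  · left; constructor <;> linarith
  · right; constructor <;> linarith

theorem Cyl_disj (n i j : ℕ) (h : i ≠ j) : Disjoint (Cyl n i) (Cyl n j) := by
  rw [Set.disjoint_left]
  intro x h1 h2
  rw [mem_Cyl] at h1 h2
  apply h
  rw [h1] at h2
  exact_mod_cast h2

theorem defDigit_succ (x : ℝ) (n : ℕ) :
    defDigit x (n + 1) = defDigit x n + 1 - 2 * bdigit x (n + 1) := by
  unfold defDigit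
  rw [Finset.sum_Icc_succ_top (by omega)]
  push_cast; ring

theorem defDigit_Cyl (n : ℕ) : ∀ (i : ℕ) (x : ℝ), x ∈ Cyl n i → defDigit x n = dd n i := by
  induction n with
  | zero => intro i x _; simp [defDigit, dd]
  | succ n ih =>
    intro i x h
    have h' := Cyl_half n i x h
    rw [defDigit_succ, ih _ _ h', dd]
    rw [mem_Cyl] at h h'
    simp only [bdigit, Nat.add_sub_cancel, h, h']
    omega

theorem adm_mem (n : ℕ) : ∀ (i : ℕ) (x : ℝ), adm n i → x ∈ Cyl n i →
    x ∈ Set.Ico (0 : ℝ) 1 ∧ ∀ j : ℕ, 1 ≤ j → j ≤ n → 0 ≤ defDigit x j := by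
  induction n with
  | zero =>
    intro i x h hx
    have h : i = 0 := h
    subst h
    refine ⟨by simpa [Cyl] using hx, fun j h1 h2 => by omega⟩
  | succ n ih =>
    intro i x h hx
    obtain ⟨a, b⟩ := ih _ x h.1 (Cyl_half n i x hx)
    refine ⟨a, fun j h1 h2 => ?_⟩
    rcases Nat.lt_or_ge n j with h3 | h3
    · obtain rfl : j = n + 1 := by omega
      rw [defDigit_Cyl _ _ _ hx]
      exact h.2
    · exact b j h1 h3

theorem adm_pow (n i p : ℕ) (h : adm n i) : adm (n + p) (2 ^ p * i) := by
  induction p with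
  | zero => simpa
  | succ p ih =>
    rw [pow_succ', mul_assoc, ← add_assoc, adm_even]
    have := adm_nonneg _ _ ih
    exact ⟨ih, by omega⟩

theorem pow_div_eq (n p : ℕ) (a : ℝ) : 2 ^ p * a / 2 ^ (n + p) = a / 2 ^ n := by
  rw [pow_add]; field_simp

theorem left_mem_Cyl (n i : ℕ) : (i : ℝ) / 2 ^ n ∈ Cyl n i := by
  unfold Cyl
  refine ⟨le_rfl, ?_⟩
  gcongr; linarith

theorem adm_Omega (n i : ℕ) (h : adm n i) : (i : ℝ) / 2 ^ n ∈ OmegaL := by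
  have key : ∀ p, (i : ℝ) / 2 ^ n ∈ Cyl (n + p) (2 ^ p * i) := by
    intro p
    have := left_mem_Cyl (n + p) (2 ^ p * i)
    push_cast at this
    rwa [pow_div_eq] at this
  refine ⟨(adm_mem n i _ h (left_mem_Cyl n i)).1, fun j hj => ?_⟩
  exact (adm_mem _ _ _ (adm_pow n i j h) (key j)).2 j hj (by omega)

theorem Omega_adm (x : ℝ) (hx : x ∈ OmegaL) (n : ℕ) : ∃ i, adm n i ∧ x ∈ Cyl n i := by
  induction n with
  | zero => exact ⟨0, rfl, by simpa [Cyl] using hx.1⟩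
  | succ n ih =>
    obtain ⟨i, hi, hc⟩ := ih
    have hd := hx.2 (n + 1) (by omega)
    rcases Cyl_split n i x hc with h | h
    · rw [defDigit_Cyl _ _ _ h, dd_even] at hd
      exact ⟨_, (adm_even n i).2 ⟨hi, hd⟩, h⟩
    · rw [defDigit_Cyl _ _ _ h, dd_odd] at hd
      exact ⟨_, (adm_odd n i).2 ⟨hi, hd⟩, h⟩

theorem small_tendsto (n : ℕ) :
    Filter.Tendsto (fun p : ℕ => (((n + p : ℕ) : ℝ) + 1) / 2 ^ (n + p)) Filter.atTop (nhds 0) := by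
  have h1 : Filter.Tendsto (fun p : ℕ => ((p : ℝ) + 1) / 2 ^ p) Filter.atTop (nhds 0) := by
    have a := tendsto_self_mul_const_pow_of_lt_one (r := (1 / 2 : ℝ)) (by norm_num) (by norm_num)
    have b := tendsto_pow_atTop_nhds_zero_of_lt_one (r := (1 / 2 : ℝ)) (by norm_num) (by norm_num)
    have c := a.add b
    rw [add_zero] at c
    refine c.congr fun p => ?_
    rw [div_pow, one_pow]; ring
  have h2 := h1.comp (Filter.tendsto_add_atTop_nat n)
  refine h2.congr fun p => ?_
  simp only [Function.comp, add_comm p n]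

theorem gg_le (n j : ℕ) (t : ℝ) (ht : t ∈ OmegaL) (hle : t ≤ (j : ℝ) / 2 ^ n) : gg t ≤ FF n j := by
  choose i hi hc using fun p => Omega_adm t ht (n + p)
  have hlim : Filter.Tendsto (fun p => (i p : ℝ) / 2 ^ (n + p)) Filter.atTop (nhds t) := by
    have lo : Filter.Tendsto (fun p : ℕ => t - (((n + p : ℕ) : ℝ) + 1) / 2 ^ (n + p))
        Filter.atTop (nhds t) := by
      simpa using tendsto_const_nhds.sub (small_tendsto n)
    refine tendsto_of_tendsto_of_tendsto_of_le_of_le lo tendsto_const_nhds ?_ ?_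
    · intro p
      have := (hc p).2
      have h1 : (1 : ℝ) / 2 ^ (n + p) ≤ (((n + p : ℕ) : ℝ) + 1) / 2 ^ (n + p) := by
        gcongr
        have : (0 : ℝ) ≤ ((n + p : ℕ) : ℝ) := by positivity
        linarith
      rw [add_div] at this
      show t - _ ≤ _
      linarith
    · intro p; exact (hc p).1
  have hg : Continuous gg := tak_cont.add continuous_id
  refine le_of_tendsto ((hg.tendsto t).comp hlim) (Filter.Eventually.of_forall fun p => ?_)
  simp only [Function.comp]
  rw [gg_adm _ _ (hi p), ← FF_pow n j p]
  apply FF_mono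
  have h1 := (hc p).1.trans hle
  rw [← pow_div_eq n p, div_le_div_iff_of_pos_right (by positivity)] at h1
  exact_mod_cast h1

theorem gg_ge (n j : ℕ) : ∃ t ∈ OmegaL, t ≤ (j : ℝ) / 2 ^ n ∧ FF n j ≤ gg t + (n + 1) / 2 ^ n := by
  have h0 : (0 : ℝ) ≤ ((n : ℝ) + 1) / 2 ^ n := by positivity
  induction j with
  | zero =>
    have a0 : adm n 0 := by simpa using adm_pow 0 0 n rfl
    refine ⟨_, adm_Omega n 0 a0, le_rfl, ?_⟩
    rw [gg_adm n 0 a0]; linarith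
  | succ j ih =>
    by_cases h : adm n j
    · refine ⟨_, adm_Omega n j h, by gcongr; simp, ?_⟩
      rw [gg_adm n j h, FF_succ]
      have : (ww n j : ℝ) ≤ n + 1 := by exact_mod_cast ww_le n j
      gcongr
    · obtain ⟨t, h1, h2, h3⟩ := ih
      refine ⟨t, h1, h2.trans (by gcongr; simp), ?_⟩
      rw [FF_succ]
      simpa [ww, h] using h3

theorem takagiS_dyadic (n j : ℕ) : takagiS ((j : ℝ) / 2 ^ n) = FF n j := by
  have hb : ∀ y ∈ {y | ∃ t ∈ OmegaL, t ≤ (j : ℝ) / 2 ^ n ∧ y = takagi t + t}, y ≤ FF n j := by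
    rintro y ⟨t, ht, hle, rfl⟩
    exact gg_le n j t ht hle
  unfold takagiS
  apply le_antisymm
  · obtain ⟨t, h1, h2, _⟩ := gg_ge n j
    exact csSup_le ⟨_, t, h1, h2, rfl⟩ hb
  · have hlim : Filter.Tendsto (fun p : ℕ => FF n j - (((n + p : ℕ) : ℝ) + 1) / 2 ^ (n + p))
        Filter.atTop (nhds (FF n j)) := by
      simpa using tendsto_const_nhds.sub (small_tendsto n)
    refine le_of_tendsto hlim (Filter.Eventually.of_forall fun p => ?_)
    obtain ⟨t, h1, h2, h3⟩ := gg_ge (n + p) (2 ^ p * j)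
    rw [FF_pow] at h3
    push_cast at h2 h3 ⊢
    rw [pow_div_eq] at h2
    have : gg t ≤ sSup {y | ∃ t ∈ OmegaL, t ≤ (j : ℝ) / 2 ^ n ∧ y = takagi t + t} :=
      le_csSup ⟨_, hb⟩ ⟨t, h1, h2, rfl⟩
    linarith

theorem takagiS_neg : takagiS (-1) = 0 := by
  unfold takagiS
  have : {y | ∃ t ∈ OmegaL, t ≤ (-1 : ℝ) ∧ y = takagi t + t} = ∅ := by
    ext y
    simp only [Set.mem_ofPred_eq, Set.mem_empty_iff_false, iff_false]
    rintro ⟨t, ht, hle, _⟩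
    have := ht.1.1
    linarith
  rw [this, Real.sSup_empty]

/-! Part 4: the measure of cylinders -/

section meas
variable (μS : MeasureTheory.Measure ℝ)
  (hμS : ∀ a b : ℝ, a ≤ b → μS (Set.Ioc a b) = ENNReal.ofReal (takagiS b - takagiS a))

theorem mu_Ioc (hμS : ∀ a b : ℝ, a ≤ b → μS (Set.Ioc a b) = ENNReal.ofReal (takagiS b - takagiS a))
    (n j : ℕ) : μS (Set.Ioc ((j : ℝ) / 2 ^ n) (((j : ℝ) + 1) / 2 ^ n)) =
      ENNReal.ofReal (ww n j / 2 ^ n) := by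
  rw [hμS _ _ (by gcongr; linarith)]
  have : ((j : ℝ) + 1) / 2 ^ n = ((j + 1 : ℕ) : ℝ) / 2 ^ n := by push_cast; rfl
  rw [this, takagiS_dyadic, takagiS_dyadic, FF_succ]
  congr 1; ring

theorem mu_atom (hμS : ∀ a b : ℝ, a ≤ b → μS (Set.Ioc a b) = ENNReal.ofReal (takagiS b - takagiS a))
    (n j : ℕ) : μS {(j : ℝ) / 2 ^ n} = 0 := by
  rcases Nat.eq_zero_or_pos j with rfl | hj
  · have h := hμS (-1) 0 (by norm_num)
    have h0 : takagiS 0 = 0 := by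
      have := takagiS_dyadic 0 0
      simpa [FF_zero] using this
    rw [takagiS_neg, h0] at h
    simp only [sub_zero, ENNReal.ofReal_zero] at h
    refine measure_mono_null ?_ h
    intro x hx
    simp only [Set.mem_singleton_iff] at hx
    subst hx
    simp
  · have hlim : Filter.Tendsto (fun p : ℕ => ENNReal.ofReal ((((n + p : ℕ) : ℝ) + 1) / 2 ^ (n + p)))
        Filter.atTop (nhds 0) := by
      simpa using ENNReal.tendsto_ofReal (small_tendsto n)
    refine le_antisymm (ge_of_tendsto hlim (Filter.Eventually.of_forall fun p => ?_)) bot_le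
    have hpos : 1 ≤ 2 ^ p * j := Nat.mul_pos (by positivity) hj
    have h := mu_Ioc μS hμS (n + p) (2 ^ p * j - 1)
    have hw : (ww (n + p) (2 ^ p * j - 1) : ℝ) ≤ (n + p : ℕ) + 1 := by exact_mod_cast ww_le _ _
    push_cast [hpos] at h
    rw [sub_add_cancel, pow_div_eq] at h
    calc μS {(j : ℝ) / 2 ^ n} ≤ _ := measure_mono ?_
      _ = _ := h
      _ ≤ _ := ENNReal.ofReal_le_ofReal (by gcongr)
    intro x hx
    simp only [Set.mem_singleton_iff] at hx
    subst hx
    refine ⟨?_, le_rfl⟩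
    rw [← pow_div_eq n p]
    gcongr
    linarith

theorem mu_Cyl (hμS : ∀ a b : ℝ, a ≤ b → μS (Set.Ioc a b) = ENNReal.ofReal (takagiS b - takagiS a))
    (n j : ℕ) : μS (Cyl n j) = ENNReal.ofReal (ww n j / 2 ^ n) := by
  have a1 := mu_atom μS hμS n j
  have a2 := mu_atom μS hμS n (j + 1)
  push_cast at a2
  have hlt : (j : ℝ) / 2 ^ n < ((j : ℝ) + 1) / 2 ^ n := by gcongr; linarith
  rw [← mu_Ioc μS hμS]
  unfold Cyl
  apply le_antisymm
  · calc _ ≤ μS (Set.Ioc ((j : ℝ) / 2 ^ n) (((j : ℝ) + 1) / 2 ^ n) ∪ {(j : ℝ) / 2 ^ n}) := by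
          apply measure_mono
          intro x hx
          rcases hx.1.lt_or_eq with h | h
          · exact Or.inl ⟨h, hx.2.le⟩
          · exact Or.inr h.symm
      _ ≤ _ := measure_union_le _ _
      _ = _ := by rw [a1, add_zero]
  · calc _ ≤ μS (Set.Ico ((j : ℝ) / 2 ^ n) (((j : ℝ) + 1) / 2 ^ n) ∪ {((j : ℝ) + 1) / 2 ^ n}) := by
          apply measure_mono
          intro x hx
          rcases hx.2.lt_or_eq with h | h
          · exact Or.inl ⟨hx.1.le, h⟩
          · exact Or.inr h
      _ ≤ _ := measure_union_le _ _
      _ = _ := by rw [a2, add_zero]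

end meas

/-! Part 5: survival probabilities -/

noncomputable def qq : ℕ → ℕ → ℝ
  | _, 0 => 0
  | 0, _ + 1 => 1
  | p + 1, d + 1 => (qq p (d + 2) + qq p d) / 2

theorem qq_zero (p : ℕ) : qq p 0 = 0 := by cases p <;> simp [qq]

theorem qq_bd (p : ℕ) : ∀ d, 0 ≤ qq p d ∧ qq p d ≤ 1 := by
  induction p with
  | zero => intro d; cases d <;> simp [qq]
  | succ p ih =>
    intro d
    cases d with
    | zero => simp [qq]
    | succ d =>
      have h1 := ih (d + 2)
      have h2 := ih d
      simp only [qq]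
      constructor <;> linarith

theorem qq_anti (p : ℕ) : ∀ d, qq (p + 1) d ≤ qq p d := by
  induction p with
  | zero =>
    intro d
    cases d with
    | zero => simp [qq]
    | succ d => simpa [qq] using (qq_bd 1 (d + 1)).2
  | succ p ih =>
    intro d
    cases d with
    | zero => simp [qq]
    | succ d =>
      have h1 := ih (d + 2)
      have h2 := ih d
      have e : ∀ p, qq (p + 1) (d + 1) = (qq p (d + 2) + qq p d) / 2 := fun p => by rw [qq]
      rw [e, e]
      linarith

theorem qq_tendsto (d : ℕ) : Filter.Tendsto (fun p => qq p d) Filter.atTop (nhds 0) := by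
  have ex : ∀ d, ∃ l, Filter.Tendsto (fun p => qq p d) Filter.atTop (nhds l) := by
    intro d
    refine ⟨_, tendsto_atTop_ciInf (antitone_nat_of_succ_le fun p => qq_anti p d) ⟨0, ?_⟩⟩
    rintro _ ⟨p, rfl⟩
    exact (qq_bd p d).1
  choose l hl using ex
  have l0 : l 0 = 0 := by
    refine tendsto_nhds_unique (hl 0) ?_
    simp [qq_zero]
  have lb : ∀ d, 0 ≤ l d ∧ l d ≤ 1 := fun d =>
    ⟨ge_of_tendsto (hl d) (Filter.Eventually.of_forall fun p => (qq_bd p d).1),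
     le_of_tendsto (hl d) (Filter.Eventually.of_forall fun p => (qq_bd p d).2)⟩
  have lrec : ∀ d, l (d + 1) = (l (d + 2) + l d) / 2 := by
    intro d
    have h1 := (hl (d + 1)).comp (Filter.tendsto_add_atTop_nat 1)
    have h2 := ((hl (d + 2)).add (hl d)).div_const 2
    exact tendsto_nhds_unique h1 (h2.congr fun p => by simp [qq])
  have lin : ∀ d : ℕ, l d = d * l 1 ∧ l (d + 1) = (d + 1) * l 1 := by
    intro d
    induction d with
    | zero => simp [l0]
    | succ d ih =>
      have := lrec d
      refine ⟨by push_cast; exact ih.2, ?_⟩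
      push_cast
      linarith [ih.1, ih.2]
  have l1 : l 1 = 0 := by
    by_contra h
    have hpos : 0 < l 1 := lt_of_le_of_ne (lb 1).1 (Ne.symm h)
    obtain ⟨N, hN⟩ := exists_nat_gt (1 / l 1)
    rw [div_lt_iff₀ hpos] at hN
    have := (lb N).2
    rw [(lin N).1] at this
    linarith
  have : l d = 0 := by rw [(lin d).1, l1, mul_zero]
  rw [← this]; exact hl d

/-! Part 6: surviving sets -/

def EE (p n i : ℕ) : Set ℝ := {x | x ∈ Cyl n i ∧ ∀ j, n ≤ j → j ≤ n + p → 0 < defDigit x j}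

theorem EE_succ (p n i : ℕ) (h : 0 < dd n i) :
    EE (p + 1) n i = EE p (n + 1) (2 * i) ∪ EE p (n + 1) (2 * i + 1) := by
  ext x
  constructor
  · rintro ⟨hx, hj⟩
    rcases Cyl_split n i x hx with h | h
    · exact Or.inl ⟨h, fun j a b => hj j (by omega) (by omega)⟩
    · exact Or.inr ⟨h, fun j a b => hj j (by omega) (by omega)⟩
  · intro hx
    have hc : x ∈ Cyl n i := by
      rcases hx with hx | hx
      · simpa using Cyl_half _ _ _ hx.1
      · have := Cyl_half _ _ _ hx.1
        rwa [show (2 * i + 1) / 2 = i by omega] at this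
    refine ⟨hc, fun j a b => ?_⟩
    rcases a.lt_or_eq with a | a
    · rcases hx with hx | hx <;> exact hx.2 j (by omega) (by omega)
    · subst a
      rw [defDigit_Cyl _ _ _ hc]; exact h

theorem EE_empty (p n i : ℕ) (h : dd n i ≤ 0) : EE p n i = ∅ := by
  ext x
  simp only [Set.mem_empty_iff_false, iff_false]
  rintro ⟨hx, hj⟩
  have := hj n le_rfl (by omega)
  rw [defDigit_Cyl _ _ _ hx] at this
  omega

theorem EE_base (n i : ℕ) (h : 0 < dd n i) : EE 0 n i = Cyl n i := by
  ext x
  constructor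
  · exact fun hx => hx.1
  · intro hx
    refine ⟨hx, fun j a b => ?_⟩
    obtain rfl : j = n := by omega
    rw [defDigit_Cyl _ _ _ hx]; exact h

theorem EE_meas (p : ℕ) : ∀ n i, MeasurableSet (EE p n i) := by
  induction p with
  | zero =>
    intro n i
    by_cases h : 0 < dd n i
    · rw [EE_base n i h]; exact measurableSet_Ico
    · rw [EE_empty _ n i (by omega)]; exact MeasurableSet.empty
  | succ p ih =>
    intro n i
    by_cases h : 0 < dd n i
    · rw [EE_succ p n i h]; exact (ih _ _).union (ih _ _)
    · rw [EE_empty _ n i (by omega)]; exact MeasurableSet.empty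

theorem mu_EE (μS : MeasureTheory.Measure ℝ)
    (hμS : ∀ a b : ℝ, a ≤ b → μS (Set.Ioc a b) = ENNReal.ofReal (takagiS b - takagiS a))
    (p : ℕ) : ∀ n i d : ℕ, adm n i → dd n i = d →
      μS (EE p n i) = ENNReal.ofReal ((d + qq p d) / 2 ^ n) := by
  induction p with
  | zero =>
    intro n i d ha hd
    cases d with
    | zero => rw [EE_empty _ _ _ (by omega)]; simp [qq_zero]
    | succ d =>
      rw [EE_base _ _ (by omega), mu_Cyl μS hμS]
      simp only [ww, ha, if_true, hd, qq]
      push_cast; rfl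
  | succ p ih =>
    intro n i d ha hd
    cases d with
    | zero => rw [EE_empty _ _ _ (by omega)]; simp [qq_zero]
    | succ d =>
      have a1 : adm (n + 1) (2 * i) := (adm_even n i).2 ⟨ha, by omega⟩
      have a2 : adm (n + 1) (2 * i + 1) := (adm_odd n i).2 ⟨ha, by omega⟩
      rw [EE_succ _ _ _ (by omega), measure_union _ (EE_meas _ _ _),
        ih (n + 1) (2 * i) (d + 2) a1 (by rw [dd_even, hd]; push_cast; ring),
        ih (n + 1) (2 * i + 1) d a2 (by rw [dd_odd, hd]; push_cast; ring),
        ← ENNReal.ofReal_add]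
      · congr 1
        simp only [qq]
        rw [pow_succ]
        push_cast
        field_simp
        ring
      · have := (qq_bd p (d + 2)).1
        positivity
      · have := (qq_bd p d).1
        positivity
      · exact (Cyl_disj (n + 1) (2 * i) (2 * i + 1) (by omega)).mono (fun x hx => hx.1)
          (fun x hx => hx.1)

theorem mu_EEinf (μS : MeasureTheory.Measure ℝ)
    (hμS : ∀ a b : ℝ, a ≤ b → μS (Set.Ioc a b) = ENNReal.ofReal (takagiS b - takagiS a))
    (n i d : ℕ) (ha : adm n i) (hd : dd n i = d) :
    μS (⋂ p, EE p n i) = ENNReal.ofReal (d / 2 ^ n) := by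
  have h1 : Filter.Tendsto (fun p => μS (EE p n i)) Filter.atTop (nhds (μS (⋂ p, EE p n i))) := by
    refine tendsto_measure_iInter_atTop (fun p => (EE_meas p n i).nullMeasurableSet) ?_ ⟨0, ?_⟩
    · intro p q hpq x hx
      exact ⟨hx.1, fun j a b => hx.2 j a (by omega)⟩
    · rw [mu_EE μS hμS 0 n i d ha hd]; exact ENNReal.ofReal_ne_top
  refine tendsto_nhds_unique h1 ?_
  simp_rw [mu_EE μS hμS _ n i d ha hd]
  apply ENNReal.tendsto_ofReal
  simpa using ((tendsto_const_nhds (x := (d : ℝ))).add (qq_tendsto d)).div_const (2 ^ n)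

/-! Part 7: the fine set -/

theorem defDigit_shift (N k : ℕ) (x y : ℝ) (h : (2 : ℝ) ^ N * x = k + y) (j : ℕ) :
    defDigit x (N + j) = defDigit x N + defDigit y j := by
  have fl : ∀ j : ℕ, ⌊(2 : ℝ) ^ (N + j) * x⌋ = 2 ^ j * k + ⌊(2 : ℝ) ^ j * y⌋ := by
    intro j
    have : (2 : ℝ) ^ (N + j) * x = ((2 ^ j * k : ℤ) : ℝ) + 2 ^ j * y := by
      push_cast
      rw [pow_add, mul_comm ((2 : ℝ) ^ N), mul_assoc, h]; ring
    rw [this, Int.floor_intCast_add]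
  induction j with
  | zero => simp [defDigit]
  | succ j ih =>
    rw [← add_assoc, defDigit_succ, defDigit_succ, ih]
    have : bdigit x (N + j + 1) = bdigit y (j + 1) := by
      have f1 := fl j
      have f2 := fl (j + 1)
      simp only [bdigit, Nat.add_sub_cancel]
      rw [f1, add_assoc, f2, pow_succ]; ring
    rw [this]; ring

theorem bp_adm (m k : ℕ) (hB : breakpoint m k) : adm (2 * m) k ∧ dd (2 * m) k = 0 := by
  rcases hB with ⟨rfl, rfl⟩ | ⟨hm, hk, hlt, hj, h0⟩
  · simp [adm, dd]
  · have hd : dd (2 * m) k = 0 := by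
      rw [← defDigit_Cyl _ _ _ (left_mem_Cyl (2 * m) k)]; exact h0
    refine ⟨?_, hd⟩
    have hO : ∀ n ≤ 2 * m, ∃ i, adm n i ∧ (k : ℝ) / 2 ^ (2 * m) ∈ Cyl n i := by
      intro n
      induction n with
      | zero =>
        intro _
        refine ⟨0, rfl, ?_⟩
        simp only [Cyl, pow_zero, Nat.cast_zero, zero_add, div_one]
        refine ⟨by positivity, ?_⟩
        rw [div_lt_one (by positivity)]
        exact_mod_cast hlt
      | succ n ih =>
        intro hn
        obtain ⟨i, hi, hc⟩ := ih (by omega)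
        have hd : 0 ≤ defDigit ((k : ℝ) / 2 ^ (2 * m)) (n + 1) := by
          rcases hn.lt_or_eq with h | h
          · exact hj _ (by omega) (by omega)
          · rw [h, h0]
        rcases Cyl_split n i _ hc with h | h
        · rw [defDigit_Cyl _ _ _ h, dd_even] at hd
          exact ⟨_, (adm_even n i).2 ⟨hi, hd⟩, h⟩
        · rw [defDigit_Cyl _ _ _ h, dd_odd] at hd
          exact ⟨_, (adm_odd n i).2 ⟨hi, hd⟩, h⟩
    obtain ⟨i, hi, hc⟩ := hO _ le_rfl
    have : i = k := by
      by_contra hne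
      exact Set.disjoint_left.1 (Cyl_disj (2 * m) i k hne) hc (left_mem_Cyl _ _)
    rwa [this] at hi

theorem fineSet_eq (m k : ℕ) (hB : breakpoint m k) :
    fineSet m k = ⋂ p, EE p (2 * m + 1) (2 * k) := by
  obtain ⟨ha, hd⟩ := bp_adm m k hB
  generalize hN : 2 * m = N at *
  have hp : (0 : ℝ) < 2 ^ N := by positivity
  ext x
  simp only [fineSet, Set.mem_iInter, Set.mem_ofPred_eq, hN]
  constructor
  · rintro ⟨y, ⟨hy, hj⟩, rfl⟩ p
    set x := (k : ℝ) / 2 ^ N + y / 2 ^ N with hx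
    have e : (2 : ℝ) ^ N * x = k + y := by rw [hx]; field_simp
    have hc : x ∈ Cyl N k := by
      rw [mem_Cyl, e, Int.floor_eq_iff]
      push_cast
      exact ⟨by linarith [hy.1], by linarith [hy.2]⟩
    have hD : ∀ j, 1 ≤ j → 0 < defDigit x (N + j) := by
      intro j h1
      rw [defDigit_shift N k x y e, defDigit_Cyl _ _ _ hc, hd, zero_add]
      exact hj j h1
    refine ⟨?_, fun j a b => ?_⟩
    · rcases Cyl_split N k x hc with h | h
      · exact h
      · have := hD 1 le_rfl
        rw [defDigit_Cyl _ _ _ h, dd_odd] at this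
        omega
    · have := hD (j - N) (by omega)
      rwa [show N + (j - N) = j by omega] at this
  · intro h
    have hc : x ∈ Cyl N k := by simpa using Cyl_half _ _ _ (h 0).1
    have e : (2 : ℝ) ^ N * x = k + (2 ^ N * x - k) := by ring
    refine ⟨2 ^ N * x - k, ⟨?_, fun j hj => ?_⟩, by field_simp; ring⟩
    · rw [mem_Cyl, Int.floor_eq_iff] at hc
      push_cast at hc
      exact ⟨by linarith [hc.1], by linarith [hc.2]⟩
    · have h1 := (h j).2 (N + j) (by omega) (by omega)
      rw [defDigit_shift N k x _ e, defDigit_Cyl _ _ _ hc, hd, zero_add] at h1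
      exact h1

/-- The Takagi singular measure of each fine partition set `Ω^L(B)`, `B = k/2^(2m) ∈ ℬ'`,
equals `2^{-(2m+1)}`. -/
theorem takagiSingularMeasure_fineSet (μS : MeasureTheory.Measure ℝ)
    (hμS : ∀ a b : ℝ, a ≤ b → μS (Set.Ioc a b) = ENNReal.ofReal (takagiS b - takagiS a))
    (m k : ℕ) (hB : breakpoint m k) :
    μS (fineSet m k) = ENNReal.ofReal (1 / 2 ^ (2 * m + 1)) := by
  obtain ⟨ha, hd⟩ := bp_adm m k hB
  rw [fineSet_eq m k hB, mu_EEinf μS hμS (2 * m + 1) (2 * k) 1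
    ((adm_even _ _).2 ⟨ha, by omega⟩) (by rw [dd_even, hd]; rfl)]
  simp
end

section
/- The sets Ω^L_fin and Ω^L_∞ are Borel sets, and their Takagi singular measures are μ_S(Ω^L_fin) = 1 and μ_S(Ω^L_∞) = 0. Consequently, the image τ^S(Ω^L_∞) of Ω^L_∞ under the Takagi singular function has Lebesgue measure zero. -/
open MeasureTheory Set

namespace TakagiAux

open scoped Pointwise

lemma dni_nonneg (t : ℝ) : 0 ≤ distNearestInt t := abs_nonneg _

lemma dni_le (t : ℝ) : distNearestInt t ≤ 1 / 2 := abs_sub_round t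

lemma dni_of_le {t : ℝ} (h0 : 0 ≤ t) (h1 : t < 1 / 2) : distNearestInt t = t := by
  have : round t = 0 := by
    rw [round_eq, Int.floor_eq_iff]; constructor <;> push_cast <;> linarith
  simp [distNearestInt, this, abs_of_nonneg h0]

lemma dni_of_ge {t : ℝ} (h0 : 1 / 2 ≤ t) (h1 : t < 1) : distNearestInt t = 1 - t := by
  have : round t = 1 := by
    rw [round_eq, Int.floor_eq_iff]; constructor <;> push_cast <;> linarith
  rw [distNearestInt, this, abs_of_nonpos] <;> push_cast <;> linarith

lemma dni_sub_int (t : ℝ) (m : ℤ) : distNearestInt (t - m) = distNearestInt t := by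
  simp only [distNearestInt, round_sub_intCast]
  push_cast
  congr 1; ring

lemma tak_term_le (x : ℝ) (n : ℕ) :
    distNearestInt (2 ^ n * x) / 2 ^ n ≤ 1 / 2 * (1 / 2) ^ n := by
  rw [one_div_pow, ← div_eq_mul_one_div]
  exact div_le_div_of_nonneg_right (dni_le _) (by positivity)

lemma tak_summable (x : ℝ) : Summable fun n : ℕ => distNearestInt (2 ^ n * x) / 2 ^ n :=
  Summable.of_nonneg_of_le (fun n => div_nonneg (dni_nonneg _) (by positivity))
    (tak_term_le x) (summable_geometric_two.mul_left _)

lemma tak_nonneg (x : ℝ) : 0 ≤ takagi x :=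
  tsum_nonneg fun n => div_nonneg (dni_nonneg _) (by positivity)

lemma tak_le (x : ℝ) : takagi x ≤ 1 := by
  have := (tak_summable x).tsum_le_tsum (tak_term_le x) (summable_geometric_two.mul_left _)
  rw [tsum_mul_left, tsum_geometric_two] at this
  simpa [takagi] using this

lemma tak_rec (x : ℝ) : takagi x = distNearestInt x + takagi (2 * x) / 2 := by
  unfold takagi
  rw [(tak_summable x).tsum_eq_zero_add, ← tsum_div_const]
  congr 1
  · simp
  · congr 1; ext n; rw [pow_succ, div_div, mul_assoc]

lemma tak_sub_one (x : ℝ) : takagi (x - 1) = takagi x := by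
  unfold takagi
  congr 1; ext n
  have := dni_sub_int (2 ^ n * x) (2 ^ n)
  push_cast at this
  rw [mul_sub, mul_one, this]

lemma tak_left {x : ℝ} (h0 : 0 ≤ x) (h1 : x < 1 / 2) : takagi x = x + takagi (2 * x) / 2 := by
  rw [tak_rec, dni_of_le h0 h1]

lemma tak_right {x : ℝ} (h0 : 1 / 2 ≤ x) (h1 : x < 1) :
    takagi x = 1 - x + takagi (2 * x - 1) / 2 := by
  rw [tak_rec, dni_of_ge h0 h1, tak_sub_one]

lemma tak_zero : takagi 0 = 0 := by
  have := tak_left (x := 0) le_rfl (by norm_num)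
  simp at this; linarith

lemma tak_third : takagi (1 / 3) = 2 / 3 := by
  have h1 := tak_left (x := 1 / 3) (by norm_num) (by norm_num)
  have h2 := tak_right (x := 2 * (1 / 3)) (by norm_num) (by norm_num)
  have : (2 * (2 * (1 / 3)) - 1 : ℝ) = 1 / 3 := by norm_num
  rw [this] at h2
  linarith

lemma bd_succ (x : ℝ) (j : ℕ) : bdigit x (j + 1 + 1) = bdigit (2 * x) (j + 1) := by
  simp only [bdigit, Nat.add_sub_cancel]
  rw [pow_succ _ (j + 1), mul_assoc, pow_succ _ j, mul_assoc, mul_assoc]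

lemma bd_sub_one (x : ℝ) (j : ℕ) : bdigit (x - 1) (j + 1) = bdigit x (j + 1) := by
  simp only [bdigit, Nat.add_sub_cancel]
  have h : ∀ n : ℕ, ⌊(2 : ℝ) ^ n * (x - 1)⌋ = ⌊(2 : ℝ) ^ n * x⌋ - 2 ^ n := by
    intro n
    rw [mul_sub, mul_one, ← Int.floor_sub_intCast]; push_cast; rfl
  rw [h, h, pow_succ]; ring

lemma dd_zero (x : ℝ) : defDigit x 0 = 0 := by simp [defDigit]

lemma dd_eq (x : ℝ) (j : ℕ) :
    defDigit x j = (j : ℤ) - 2 * ∑ i ∈ Finset.range j, bdigit x (i + 1) := by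
  rw [defDigit, Finset.range_eq_Ico, Finset.sum_Ico_add' (fun i => bdigit x i) 0 j 1]
  rfl

lemma dd_succ (x : ℝ) (j : ℕ) :
    defDigit x (j + 1) = 1 - 2 * bdigit x 1 + defDigit (2 * x) j := by
  rw [dd_eq, dd_eq, Finset.sum_range_succ']
  simp only [bd_succ]
  push_cast; ring

lemma dd_sub_one (x : ℝ) (j : ℕ) : defDigit (x - 1) j = defDigit x j := by
  simp only [dd_eq, bd_sub_one]

lemma dd_left {x : ℝ} (h0 : 0 ≤ x) (h1 : x < 1 / 2) (j : ℕ) :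
    defDigit x (j + 1) = 1 + defDigit (2 * x) j := by
  have a : ⌊(2 : ℝ) * x⌋ = 0 := by
    rw [Int.floor_eq_iff]; constructor <;> push_cast <;> linarith
  have b : ⌊x⌋ = 0 := by
    rw [Int.floor_eq_iff]; constructor <;> push_cast <;> linarith
  rw [dd_succ]; simp [bdigit, a, b]

lemma dd_right {x : ℝ} (h0 : 1 / 2 ≤ x) (h1 : x < 1) (j : ℕ) :
    defDigit x (j + 1) = -1 + defDigit (2 * x - 1) j := by
  have a : ⌊(2 : ℝ) * x⌋ = 1 := by
    rw [Int.floor_eq_iff]; constructor <;> push_cast <;> linarith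
  have b : ⌊x⌋ = 0 := by
    rw [Int.floor_eq_iff]; constructor <;> push_cast <;> linarith
  rw [dd_succ, dd_sub_one]; simp [bdigit, a, b]

/-- Points of `[0,1)` all of whose deficient digit values exceed `-e`. -/
def A (e : ℕ) : Set ℝ := {x | x ∈ Ico (0 : ℝ) 1 ∧ ∀ j : ℕ, -(e : ℤ) < defDigit x j}

lemma A_zero : A 0 = ∅ := by
  ext x; simp only [A, mem_ofPred_eq, mem_empty_iff_false, iff_false]
  rintro ⟨_, h⟩; have := h 0; simp [dd_zero] at this

lemma A_one : A 1 = OmegaL := by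
  ext x
  simp only [A, OmegaL, mem_ofPred_eq]
  refine and_congr_right fun _ => ⟨fun h j _ => by have := h j; omega, fun h j => ?_⟩
  rcases Nat.eq_zero_or_pos j with rfl | hj
  · simp [dd_zero]
  · have := h j hj; omega

lemma A_left {e : ℕ} {x : ℝ} (h0 : 0 ≤ x) (h1 : x < 1 / 2) (he : 1 ≤ e) :
    x ∈ A e ↔ 2 * x ∈ A (e + 1) := by
  simp only [A, mem_ofPred_eq, mem_Ico]
  refine and_congr ⟨fun _ => ⟨by linarith, by linarith⟩, fun _ => ⟨h0, by linarith⟩⟩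
    ⟨fun h j => ?_, fun h j => ?_⟩
  · have := h (j + 1); rw [dd_left h0 h1] at this; push_cast; omega
  · rcases j with _ | j
    · rw [dd_zero]; omega
    · rw [dd_left h0 h1]; have := h j; push_cast at this; omega

lemma A_right {e : ℕ} {x : ℝ} (h0 : 1 / 2 ≤ x) (h1 : x < 1) :
    x ∈ A (e + 1) ↔ 2 * x - 1 ∈ A e := by
  simp only [A, mem_ofPred_eq, mem_Ico]
  refine and_congr ⟨fun _ => ⟨by linarith, by linarith⟩, fun _ => ⟨by linarith, by linarith⟩⟩
    ⟨fun h j => ?_, fun h j => ?_⟩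
  · have := h (j + 1); rw [dd_right h0 h1] at this; push_cast at this; omega
  · rcases j with _ | j
    · rw [dd_zero]; omega
    · rw [dd_right h0 h1]; have := h j; push_cast; omega

lemma dd_nat (x : ℝ) (j : ℕ) (hx : x = 0) : 0 ≤ defDigit x j := by
  subst hx; simp [dd_eq, bdigit]

lemma zero_mem_A {e : ℕ} (he : 1 ≤ e) : (0 : ℝ) ∈ A e :=
  ⟨by simp, fun j => by have := dd_nat 0 j rfl; omega⟩

lemma dd_third (j : ℕ) : 0 ≤ defDigit (1 / 3) j ∧ -1 ≤ defDigit (2 * (1 / 3)) j := by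
  induction j with
  | zero => simp [dd_zero]
  | succ j ih =>
    rw [dd_left (by norm_num) (by norm_num), dd_right (by norm_num) (by norm_num)]
    have : (2 * (2 * (1 / 3)) - 1 : ℝ) = 1 / 3 := by norm_num
    rw [this]; omega

/-- A point where the supremum over `A e` is attained. -/
lemma exists_top (e : ℕ) : ∃ t ∈ A (e + 1), takagi t + ((e + 1 : ℕ) : ℝ) * t = (e + 1 : ℕ) := by
  induction e with
  | zero =>
    refine ⟨1 / 3, ⟨by norm_num, fun j => ?_⟩, ?_⟩
    · have := (dd_third j).1; push_cast; omega
    · rw [tak_third]; norm_num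
  | succ e ih =>
    obtain ⟨t, ht, h⟩ := ih
    have h0 := ht.1.1
    have h1 := ht.1.2
    have e1 : 2 * ((1 + t) / 2) - 1 = t := by ring
    refine ⟨(1 + t) / 2, (A_right (by linarith) (by linarith)).2 (by rwa [e1]), ?_⟩
    rw [tak_right (by linarith) (by linarith), e1]
    push_cast at h ⊢; linarith

lemma val_left {e : ℕ} {x : ℝ} (h0 : 0 ≤ x) (h1 : x < 1 / 2) :
    takagi x + (e : ℝ) * x = (takagi (2 * x) + ((e + 1 : ℕ) : ℝ) * (2 * x)) / 2 := by
  rw [tak_left h0 h1]; push_cast; ring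

lemma val_right {e : ℕ} {x : ℝ} (h0 : 1 / 2 ≤ x) (h1 : x < 1) :
    takagi x + ((e + 1 : ℕ) : ℝ) * x =
      (e + 2) / 2 + (takagi (2 * x - 1) + (e : ℝ) * (2 * x - 1)) / 2 := by
  rw [tak_right h0 h1]; push_cast; ring

lemma val_le_aux (n : ℕ) : ∀ (e : ℕ) (t : ℝ), t ∈ A e →
    takagi t + (e : ℝ) * t - e ≤ (1 / 2) ^ n := by
  induction n with
  | zero =>
    intro e t ht
    have := tak_le t
    have h2 : (e : ℝ) * t ≤ e := mul_le_of_le_one_right (by positivity) ht.1.2.le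
    simp; linarith
  | succ n ih =>
    intro e t ht
    rcases e with _ | e
    · simp [A_zero] at ht
    rcases lt_or_ge t (1 / 2) with h | h
    · have := ih _ _ ((A_left ht.1.1 h (by omega)).1 ht)
      rw [val_left ht.1.1 h, pow_succ]
      have h3 : (0 : ℝ) ≤ e := by positivity
      push_cast at this ⊢; linarith
    · have := ih _ _ ((A_right h ht.1.2).1 ht)
      rw [val_right h ht.1.2, pow_succ]
      push_cast at this ⊢; linarith

lemma val_le {e : ℕ} {t : ℝ} (ht : t ∈ A e) : takagi t + (e : ℝ) * t ≤ e := by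
  have h : Filter.Tendsto (fun n : ℕ => (1 / 2 : ℝ) ^ n) Filter.atTop (nhds 0) :=
    tendsto_pow_atTop_nhds_zero_of_lt_one (by norm_num) (by norm_num)
  have := ge_of_tendsto' h (fun n => val_le_aux n e t ht)
  linarith

lemma val_nonneg {e : ℕ} {t : ℝ} (ht : t ∈ A e) : 0 ≤ takagi t + (e : ℝ) * t :=
  add_nonneg (tak_nonneg t) (mul_nonneg (by positivity) ht.1.1)

/-- The value set defining `H`. -/
def VS (e : ℕ) (x : ℝ) : Set ℝ := {y | ∃ t ∈ A e, t ≤ x ∧ y = takagi t + (e : ℝ) * t}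

/-- The family of singular functions. -/
noncomputable def H (e : ℕ) (x : ℝ) : ℝ := sSup (VS e x)

lemma H_one : takagiS = H 1 := by
  funext x; simp [takagiS, H, VS, A_one]

lemma VS_bdd (e : ℕ) (x : ℝ) : BddAbove (VS e x) := by
  refine ⟨e, ?_⟩; rintro y ⟨t, ht, _, rfl⟩; exact val_le ht

lemma le_H {e : ℕ} {x t : ℝ} (ht : t ∈ A e) (h : t ≤ x) : takagi t + (e : ℝ) * t ≤ H e x :=
  le_csSup (VS_bdd e x) ⟨t, ht, h, rfl⟩

lemma H_le {e : ℕ} {x b : ℝ} (hb : 0 ≤ b)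
    (h : ∀ t ∈ A e, t ≤ x → takagi t + (e : ℝ) * t ≤ b) : H e x ≤ b := by
  apply Real.sSup_le _ hb
  rintro y ⟨t, ht, h', rfl⟩; exact h t ht h'

lemma H_nonneg (e : ℕ) (x : ℝ) : 0 ≤ H e x := by
  apply Real.sSup_nonneg
  rintro y ⟨t, ht, h', rfl⟩; exact val_nonneg ht

lemma H_le_e (e : ℕ) (x : ℝ) : H e x ≤ e := H_le (by positivity) fun _ ht _ => val_le ht

lemma H_mono (e : ℕ) : Monotone (H e) := fun x y hxy =>
  H_le (H_nonneg _ _) fun _ ht h => le_H ht (h.trans hxy)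

lemma H_zero (x : ℝ) : H 0 x = 0 :=
  le_antisymm (by simpa using H_le_e 0 x) (H_nonneg _ _)

lemma H_ge_one (e : ℕ) {x : ℝ} (hx : 1 ≤ x) : H e x = e := by
  refine le_antisymm (H_le_e e x) ?_
  rcases e with _ | e
  · simp [H_nonneg]
  · obtain ⟨t, ht, h⟩ := exists_top e
    rw [← h]; exact le_H ht (ht.1.2.le.trans hx)

lemma H_le_zero (e : ℕ) {x : ℝ} (hx : x ≤ 0) : H e x = 0 := by
  refine le_antisymm (H_le le_rfl fun t ht h => ?_) (H_nonneg _ _)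
  have : t = 0 := le_antisymm (h.trans hx) ht.1.1
  simp [this, tak_zero]

lemma H_right (e : ℕ) {x : ℝ} (h0 : 1 / 2 ≤ x) :
    H (e + 1) x = (e + 2) / 2 + H e (2 * x - 1) / 2 := by
  have hn := H_nonneg e (2 * x - 1)
  have he : (0 : ℝ) ≤ e := by positivity
  apply le_antisymm
  · refine H_le (by positivity) fun t ht h => ?_
    rcases lt_or_ge t (1 / 2) with h' | h'
    · have := val_le ((A_left ht.1.1 h' (by omega)).1 ht)
      rw [val_left ht.1.1 h']; push_cast at this ⊢; linarith
    · have := le_H ((A_right h' ht.1.2).1 ht) (show 2 * t - 1 ≤ 2 * x - 1 by linarith)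
      rw [val_right h' ht.1.2]; linarith
  · rcases e with _ | e
    · rw [H_zero]
      obtain ⟨t, ht, h⟩ := exists_top 1
      have e1 : 2 * (t / 2) = t := by ring
      have h1 : t / 2 ∈ A 1 :=
        (A_left (by linarith [ht.1.1]) (by linarith [ht.1.2]) le_rfl).2 (by rwa [e1])
      have := le_H h1 (show t / 2 ≤ x by linarith [ht.1.2])
      rw [val_left (by linarith [ht.1.1]) (by linarith [ht.1.2]), e1] at this
      push_cast at this h ⊢
      simp only [zero_add] at *
      linarith
    · suffices H (e + 1) (2 * x - 1) ≤ 2 * H (e + 1 + 1) x - (((e + 1 : ℕ) : ℝ) + 2) by linarith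
      have key : ∀ t ∈ A (e + 1), t ≤ 2 * x - 1 → takagi t + ((e + 1 : ℕ) : ℝ) * t ≤
          2 * H (e + 1 + 1) x - (((e + 1 : ℕ) : ℝ) + 2) := by
        intro t ht h
        have e1 : 2 * ((1 + t) / 2) - 1 = t := by ring
        have g0 := ht.1.1
        have g1 := ht.1.2
        have h1 : (1 + t) / 2 ∈ A (e + 1 + 1) :=
          (A_right (by linarith) (by linarith)).2 (by rwa [e1])
        have := le_H h1 (show (1 + t) / 2 ≤ x by linarith)
        rw [val_right (by linarith) (by linarith), e1] at this
        linarith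
      refine H_le ?_ key
      exact (val_nonneg (zero_mem_A (by omega))).trans
        (key 0 (zero_mem_A (by omega)) (by linarith))

lemma H_left (e : ℕ) {x : ℝ} (h0 : x ≤ 1 / 2) :
    H (e + 1) x = H (e + 2) (2 * x) / 2 := by
  rcases eq_or_lt_of_le h0 with rfl | h0
  · rw [H_right e le_rfl, H_le_zero _ (by norm_num), H_ge_one _ (by norm_num)]; push_cast; ring
  apply le_antisymm
  · refine H_le (by have := H_nonneg (e + 2) (2 * x); positivity) fun t ht h => ?_
    have h' : t < 1 / 2 := by linarith
    have := le_H ((A_left ht.1.1 h' (by omega)).1 ht) (show 2 * t ≤ 2 * x by linarith)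
    rw [val_left ht.1.1 h']; linarith
  · suffices H (e + 2) (2 * x) ≤ 2 * H (e + 1) x by linarith
    refine H_le (by have := H_nonneg (e + 1) x; positivity) fun t ht h => ?_
    have e1 : 2 * (t / 2) = t := by ring
    have g0 := ht.1.1
    have g1 := ht.1.2
    have h1 : t / 2 ∈ A (e + 1) :=
      (A_left (by linarith) (by linarith) (by omega)).2 (by rwa [e1])
    have := le_H h1 (show t / 2 ≤ x by linarith)
    rw [val_left (by linarith) (by linarith), e1] at this
    linarith

lemma H_dense (n : ℕ) : ∀ (e : ℕ) (y : ℝ), 0 ≤ y → y ≤ e →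
    ∃ x, |H e x - y| ≤ (e + n) / 2 ^ n := by
  induction n with
  | zero =>
    intro e y h0 h1
    refine ⟨0, ?_⟩
    rw [H_le_zero _ le_rfl, abs_le]; constructor <;> push_cast <;> linarith
  | succ n ih =>
    intro e y h0 h1
    rcases e with _ | e
    · refine ⟨0, ?_⟩
      have : y = 0 := le_antisymm (by simpa using h1) h0
      rw [H_zero, this]; simp; positivity
    rcases le_total y ((e + 2) / 2) with h | h
    · obtain ⟨x, hx⟩ := ih (e + 2) (2 * y) (by linarith) (by push_cast; linarith)
      refine ⟨min (x / 2) (1 / 2), ?_⟩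
      have : H (e + 2) (2 * min (x / 2) (1 / 2)) = H (e + 2) x := by
        rcases le_total x 1 with hx1 | hx1
        · rw [min_eq_left (by linarith)]; congr 1; ring
        · rw [min_eq_right (by linarith), H_ge_one _ hx1, H_ge_one _ (by norm_num)]
      rw [H_left e (min_le_right _ _), this,
        show H (e + 2) x / 2 - y = (H (e + 2) x - 2 * y) / 2 by ring, abs_div, abs_two, pow_succ,
        ← div_div]
      refine div_le_div_of_nonneg_right (hx.trans (le_of_eq ?_)) (by norm_num)
      push_cast; ring
    · obtain ⟨x, hx⟩ := ih e (2 * y - (e + 2)) (by linarith) (by push_cast at h1; linarith)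
      refine ⟨max ((x + 1) / 2) (1 / 2), ?_⟩
      have : H e (2 * max ((x + 1) / 2) (1 / 2) - 1) = H e x := by
        rcases le_total 0 x with hx1 | hx1
        · rw [max_eq_left (by linarith)]; congr 1; ring
        · rw [max_eq_right (by linarith), H_le_zero _ hx1, H_le_zero _ (by norm_num)]
      rw [H_right e (le_max_right _ _), this,
        show (e + 2 : ℝ) / 2 + H e x / 2 - y = (H e x - (2 * y - (e + 2))) / 2 by ring, abs_div,
        abs_two, pow_succ, ← div_div]
      refine div_le_div_of_nonneg_right (hx.trans ?_) (by norm_num)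
      apply div_le_div_of_nonneg_right _ (by positivity)
      push_cast; linarith

lemma exists_between {a b : ℝ} (h0 : 0 ≤ a) (hab : a < b) (h1 : b ≤ 1) :
    ∃ x, a < H 1 x ∧ H 1 x < b := by
  have ht : Filter.Tendsto (fun n : ℕ => (((1 : ℕ) : ℝ) + n) / 2 ^ n) Filter.atTop (nhds 0) := by
    have h1 : Filter.Tendsto (fun n : ℕ => (1 / 2 : ℝ) ^ n) Filter.atTop (nhds 0) :=
      tendsto_pow_atTop_nhds_zero_of_lt_one (by norm_num) (by norm_num)
    have h2 := tendsto_self_mul_const_pow_of_lt_one (r := (1 / 2 : ℝ)) (by norm_num) (by norm_num)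
    have := h1.add h2
    simp only [add_zero] at this
    refine this.congr fun n => ?_
    rw [one_div_pow]; push_cast; ring
  obtain ⟨n, hn⟩ := (ht.eventually (gt_mem_nhds (show 0 < (b - a) / 2 by linarith))).exists
  obtain ⟨x, hx⟩ := H_dense n 1 ((a + b) / 2) (by linarith) (by push_cast; linarith)
  have := abs_lt.1 (hx.trans_lt hn)
  exact ⟨x, by linarith [this.1], by linarith [this.2]⟩

lemma vol_rec {e : ℕ} {X L R : Set ℝ} (hX : X ⊆ Ico 0 1)
    (hL : ∀ x ∈ X, x < 1 / 2 → 2 * x ∈ L) (hR : ∀ x ∈ X, 1 / 2 ≤ x → 2 * x - 1 ∈ R) :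
    volume (H (e + 1) '' X) ≤
      2⁻¹ * volume (H (e + 2) '' L) + 2⁻¹ * volume (H e '' R) := by
  have hsub : H (e + 1) '' X ⊆ ((2⁻¹ : ℝ) • (H (e + 2) '' L)) ∪
      ((fun y => ((e : ℝ) + 2) / 2 + y) '' ((2⁻¹ : ℝ) • (H e '' R))) := by
    rintro _ ⟨x, hx, rfl⟩
    rcases lt_or_ge x (1 / 2) with h | h
    · left
      refine ⟨_, ⟨_, hL x hx h, rfl⟩, ?_⟩
      rw [H_left e h.le]; simp only [smul_eq_mul]; ring
    · right
      refine ⟨_, ⟨_, ⟨_, hR x hx h, rfl⟩, rfl⟩, ?_⟩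
      rw [H_right e h]; simp only [smul_eq_mul]; ring
  refine (measure_mono hsub).trans ((measure_union_le _ _).trans ?_)
  have h2 : ENNReal.ofReal |(2⁻¹ : ℝ)| = 2⁻¹ := by
    rw [abs_of_pos (by norm_num), ENNReal.ofReal_inv_of_pos (by norm_num)]; simp
  rw [image_add_left, measure_preimage_add, Measure.addHaar_smul, Measure.addHaar_smul]
  simp only [Module.finrank_self, pow_one, h2]
  exact le_rfl

lemma vol_zero (X : Set ℝ) : volume (H 0 '' X) = 0 := by
  refine measure_mono_null (t := {0}) ?_ (by simp)
  rintro _ ⟨x, _, rfl⟩; simp [H_zero]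

/-- Points whose walk started at `e` is at `1` at time `n`. -/
def E (n e : ℕ) : Set ℝ := {x | x ∈ Ico (0 : ℝ) 1 ∧ defDigit x n = 1 - e}

lemma vol_E (N : ℕ) : ∀ e : ℕ, ∑ n ∈ Finset.range N, volume (H (e + 1) '' E n (e + 1)) ≤ 2 := by
  induction N with
  | zero => intro e; simp
  | succ N ih =>
    intro e
    have hs : ∀ n, volume (H (e + 1) '' E (n + 1) (e + 1)) ≤
        2⁻¹ * volume (H (e + 2) '' E n (e + 2)) + 2⁻¹ * volume (H e '' E n e) := by
      intro n
      refine vol_rec (fun x hx => hx.1) (fun x hx h => ⟨⟨?_, ?_⟩, ?_⟩)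
        (fun x hx h => ⟨⟨?_, ?_⟩, ?_⟩)
      · linarith [hx.1.1]
      · linarith [hx.1.1]
      · have := hx.2; rw [dd_left hx.1.1 h] at this; push_cast at this ⊢; linarith
      · linarith [hx.1.1]
      · linarith [hx.1.2]
      · have := hx.2; rw [dd_right h hx.1.2] at this; push_cast at this ⊢; linarith
    have hhalf : (2⁻¹ : ENNReal) * 2 = 1 := ENNReal.inv_mul_cancel (by simp) (by simp)
    rw [Finset.sum_range_succ']
    refine (add_le_add_left (Finset.sum_le_sum fun n _ => hs n) _).trans ?_
    rw [Finset.sum_add_distrib, ← Finset.mul_sum, ← Finset.mul_sum]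
    have i1 : 2⁻¹ * ∑ n ∈ Finset.range N, volume (H (e + 2) '' E n (e + 2)) ≤ 1 := by
      rw [← hhalf]; gcongr; exact ih (e + 1)
    rw [← one_add_one_eq_two, add_assoc]
    rw [one_add_one_eq_two]
    refine (add_le_add i1 (?_ : _ ≤ (1 : ENNReal))).trans_eq one_add_one_eq_two
    rcases e with _ | e
    · simp only [vol_zero, Finset.sum_const_zero, mul_zero, zero_add]
      refine (measure_mono (t := Icc 0 1) ?_).trans (by simp)
      rintro _ ⟨x, _, rfl⟩
      exact ⟨H_nonneg _ _, by simpa using H_le_e 1 x⟩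
    · have : E 0 (e + 1 + 1) = ∅ := by
        ext x; simp only [E, dd_zero, mem_ofPred_eq, mem_empty_iff_false, iff_false]
        rintro ⟨_, h⟩; push_cast at h; omega
      rw [this]
      simp only [image_empty, measure_empty, add_zero]
      rw [← hhalf]; gcongr; exact ih e

/-- Points whose walk started at `e` has reached `0` by time `N`. -/
def Q (N e : ℕ) : Set ℝ := {x | x ∈ Ico (0 : ℝ) 1 ∧ ∃ j ≤ N, defDigit x j ≤ -(e : ℤ)}

lemma vol_Q (N : ℕ) : ∀ e : ℕ, volume (H e '' Q N e) = 0 := by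
  induction N with
  | zero =>
    intro e
    rcases e with _ | e
    · exact vol_zero _
    have : Q 0 (e + 1) = ∅ := by
      ext x; simp only [Q, mem_ofPred_eq, mem_empty_iff_false, iff_false]
      rintro ⟨_, j, hj, h⟩
      obtain rfl : j = 0 := by omega
      rw [dd_zero] at h; push_cast at h; omega
    simp [this]
  | succ N ih =>
    intro e
    rcases e with _ | e
    · exact vol_zero _
    have := vol_rec (e := e) (X := Q (N + 1) (e + 1)) (L := Q N (e + 2)) (R := Q N e)
      (fun x hx => hx.1) ?_ ?_
    · rw [ih, ih] at this; simpa using this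
    · rintro x ⟨hx, j, hj, hd⟩ h
      rcases j with _ | j
      · rw [dd_zero] at hd; push_cast at hd; omega
      rw [dd_left hx.1 h] at hd
      exact ⟨⟨by linarith [hx.1], by linarith⟩, j, by omega, by push_cast at hd ⊢; linarith⟩
    · rintro x ⟨hx, j, hj, hd⟩ h
      rcases j with _ | j
      · rw [dd_zero] at hd; push_cast at hd; omega
      rw [dd_right h hx.2] at hd
      exact ⟨⟨by linarith, by linarith [hx.2]⟩, j, by omega, by push_cast at hd ⊢; linarith⟩

lemma vol_compl : volume (H 1 '' OmegaLᶜ) = 0 := by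
  have : H 1 '' OmegaLᶜ ⊆ (⋃ N, H 1 '' Q N 1) ∪ {0, 1} := by
    rintro _ ⟨x, hx, rfl⟩
    rcases lt_or_ge x 0 with h | h0
    · right; left; exact H_le_zero _ h.le
    rcases lt_or_ge x 1 with h1 | h
    · left
      rw [← A_one] at hx
      simp only [A, mem_compl_iff, mem_ofPred_eq, not_and, not_forall, not_lt] at hx
      obtain ⟨j, hj⟩ := hx ⟨h0, h1⟩
      exact mem_iUnion.2 ⟨j, x, ⟨⟨h0, h1⟩, j, le_rfl, hj⟩, rfl⟩
    · right; right; simpa using H_ge_one 1 h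
  refine measure_mono_null this (measure_union_null (measure_iUnion_null fun N => vol_Q N 1) ?_)
  exact (Set.toFinite _).measure_zero _

lemma vol_inf : volume (H 1 '' OmegaLinf) = 0 := by
  have hs : ∑' n, volume (H 1 '' E n 1) ≠ ⊤ := by
    refine ne_top_of_le_ne_top (b := 2) (by simp) ?_
    exact ENNReal.tsum_le_of_sum_range_le fun N => vol_E N 0
  refine measure_mono_null ?_ (measure_limsup_atTop_eq_zero hs)
  rintro _ ⟨x, ⟨hx, hinf⟩, rfl⟩
  rw [Filter.mem_limsup_iff_frequently_mem, Nat.frequently_atTop_iff_infinite]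
  refine hinf.mono fun j hj => ⟨x, ⟨hx.1, ?_⟩, rfl⟩
  rw [hj.2]; simp

lemma meas_dd (j : ℕ) : Measurable fun x => defDigit x j := by
  have hb : ∀ i, Measurable fun x => bdigit x i := by
    intro i
    unfold bdigit
    exact (Int.measurable_floor.comp (measurable_const.mul measurable_id)).sub
      ((Int.measurable_floor.comp (measurable_const.mul measurable_id)).const_mul 2)
  unfold defDigit
  exact measurable_const.sub ((Finset.measurable_sum _ fun i _ => hb i).const_mul 2)

lemma meas_Omega : MeasurableSet OmegaL := by
  have : OmegaL = Ico 0 1 ∩ ⋂ (j : ℕ) (_ : 1 ≤ j), (fun x => defDigit x j) ⁻¹' Ici 0 := by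
    ext x; simp [OmegaL]
  rw [this]
  exact measurableSet_Ico.inter (MeasurableSet.iInter fun j => MeasurableSet.iInter fun _ =>
    meas_dd j (MeasurableSet.of_discrete))

lemma meas_inf : MeasurableSet OmegaLinf := by
  have : OmegaLinf = OmegaL ∩ ⋂ N : ℕ, ⋃ (j : ℕ) (_ : N < j),
      (fun x => defDigit x j) ⁻¹' {0} := by
    ext x
    simp only [OmegaLinf, mem_ofPred_eq, mem_inter_iff, mem_iInter, mem_iUnion, mem_preimage,
      mem_singleton_iff, exists_prop, Set.infinite_iff_exists_gt]
    refine and_congr_right fun _ => forall_congr' fun N => exists_congr fun j => ?_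
    constructor
    · rintro ⟨⟨_, h⟩, h'⟩; exact ⟨h', h⟩
    · rintro ⟨h, h'⟩; exact ⟨⟨by omega, h'⟩, h⟩
  rw [this]
  exact meas_Omega.inter (MeasurableSet.iInter fun N => MeasurableSet.iUnion fun j =>
    MeasurableSet.iUnion fun _ => meas_dd j (MeasurableSet.of_discrete))

section
variable (μ : Measure ℝ)
  (hμ : ∀ a b : ℝ, a ≤ b → μ (Ioc a b) = ENNReal.ofReal (H 1 b - H 1 a))
include hμ

lemma mu_Iic (x : ℝ) : μ (Iic x) = ENNReal.ofReal (H 1 x) := by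
  have hu : Iic x = ⋃ n : ℕ, Ioc (-(n : ℝ)) x := by
    ext y
    simp only [mem_Iic, mem_iUnion, mem_Ioc, exists_and_right]
    refine ⟨fun h => ⟨?_, h⟩, fun h => h.2⟩
    obtain ⟨n, hn⟩ := exists_nat_gt (-y)
    exact ⟨n, by linarith⟩
  have hm : Monotone fun n : ℕ => Ioc (-(n : ℝ)) x := by
    intro m n hmn
    exact Ioc_subset_Ioc_left (by simpa using hmn)
  rw [hu, hm.measure_iUnion]
  have hv : ∀ n : ℕ, μ (Ioc (-(n : ℝ)) x) ≤ ENNReal.ofReal (H 1 x) := by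
    intro n
    rcases le_total (-(n : ℝ)) x with h | h
    · rw [hμ _ _ h]; exact ENNReal.ofReal_le_ofReal (by linarith [H_nonneg 1 (-(n : ℝ))])
    · simp [Ioc_eq_empty_of_le h]
  refine le_antisymm (iSup_le hv) ?_
  obtain ⟨n, hn⟩ := exists_nat_gt (-x)
  refine le_iSup_of_le n ?_
  rw [hμ _ _ (by linarith), H_le_zero 1 (x := -(n : ℝ)) (by simp), sub_zero]

lemma mu_univ : μ univ = 1 := by
  have hu : (univ : Set ℝ) = ⋃ n : ℕ, Iic (n : ℝ) := by
    ext y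
    obtain ⟨n, hn⟩ := exists_nat_gt y
    simp only [mem_univ, mem_iUnion, mem_Iic, true_iff]
    exact ⟨n, hn.le⟩
  have hm : Monotone fun n : ℕ => Iic (n : ℝ) := by
    intro m n hmn
    exact Iic_subset_Iic.2 (by simpa using hmn)
  rw [hu, hm.measure_iUnion]
  apply le_antisymm
  · refine iSup_le fun n => ?_
    rw [mu_Iic μ hμ]
    exact ENNReal.ofReal_le_one.2 (by simpa using H_le_e 1 n)
  · refine le_iSup_of_le 1 ?_
    rw [mu_Iic μ hμ, H_ge_one _ (by simp)]; simp

lemma mu_map : μ.map (H 1) = volume.restrict (Icc 0 1) := by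
  have hf : IsFiniteMeasure μ := ⟨by rw [mu_univ μ hμ]; simp⟩
  have hmeas := (H_mono 1).measurable
  have := Measure.isFiniteMeasure_map μ (H 1)
  refine Measure.ext_of_Iic _ _ fun y => ?_
  rw [Measure.map_apply hmeas measurableSet_Iic, Measure.restrict_apply measurableSet_Iic]
  rcases lt_or_ge y 0 with hy | hy
  · have h1 : H 1 ⁻¹' Iic y = ∅ := by
      ext x; simp only [mem_preimage, mem_Iic, mem_empty_iff_false, iff_false, not_le]
      exact hy.trans_le (H_nonneg _ _)
    have h2 : Iic y ∩ Icc 0 1 = ∅ := by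
      ext x; simp only [mem_inter_iff, mem_Iic, mem_Icc, mem_empty_iff_false, iff_false]
      rintro ⟨h, h', _⟩; linarith
    rw [h1, h2]; simp
  rcases le_or_gt 1 y with hy1 | hy1
  · have h1 : H 1 ⁻¹' Iic y = univ := by
      ext x; simp only [mem_preimage, mem_Iic, mem_univ, iff_true]
      exact (by simpa using H_le_e 1 x : H 1 x ≤ 1).trans hy1
    have h2 : Iic y ∩ Icc 0 1 = Icc 0 1 := by
      ext x; simp only [mem_inter_iff, mem_Iic, mem_Icc, and_iff_right_iff_imp]
      rintro ⟨h, h'⟩; linarith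
    rw [h1, h2, mu_univ μ hμ]; simp
  have h2 : Iic y ∩ Icc 0 1 = Icc 0 y := by
    ext x; simp only [mem_inter_iff, mem_Iic, mem_Icc]
    constructor
    · rintro ⟨a, b, c⟩; exact ⟨b, a⟩
    · rintro ⟨a, b⟩; exact ⟨b, a, by linarith⟩
  rw [h2, Real.volume_Icc, sub_zero]
  apply le_antisymm
  · refine ENNReal.le_of_forall_pos_le_add fun ε hε _ => ?_
    obtain ⟨x, hx, hx'⟩ := exists_between hy (lt_min hy1 (show y < y + ε by
      have : (0 : ℝ) < ε := hε
      linarith)) (min_le_left _ _)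
    have hsub : H 1 ⁻¹' Iic y ⊆ Iic x := by
      intro z hz
      by_contra hzx
      have := H_mono 1 (not_le.1 hzx).le
      have hz' : H 1 z ≤ y := hz
      linarith
    refine (measure_mono hsub).trans ?_
    rw [mu_Iic μ hμ]
    have : H 1 x ≤ y + ε := (hx'.trans_le (min_le_right _ _)).le
    refine (ENNReal.ofReal_le_ofReal this).trans ?_
    exact ENNReal.ofReal_add_le.trans (by rw [ENNReal.ofReal_coe_nnreal])
  · refine le_of_forall_lt fun c hc => ?_
    rcases eq_or_lt_of_le hy with rfl | hy0
    · simp at hc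
    have hc' : c ≠ ⊤ := hc.ne_top
    have hcy : c.toReal < y := by
      rw [← ENNReal.toReal_ofReal hy]
      exact (ENNReal.toReal_lt_toReal hc' (by simp)).2 hc
    obtain ⟨x, hx, hx'⟩ := exists_between ENNReal.toReal_nonneg hcy hy1.le
    have hsub : Iic x ⊆ H 1 ⁻¹' Iic y := fun z hz => (H_mono 1 hz).trans hx'.le
    refine lt_of_lt_of_le ?_ (measure_mono hsub)
    rw [mu_Iic μ hμ, ENNReal.lt_ofReal_iff_toReal_lt hc']
    exact hx

lemma mu_null {X : Set ℝ} (h : volume (H 1 '' X) = 0) : μ X = 0 := by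
  obtain ⟨t, ht, hm, h0⟩ := exists_measurable_superset_of_null h
  refine measure_mono_null (image_subset_iff.1 ht) ?_
  rw [← Measure.map_apply (H_mono 1).measurable hm, mu_map μ hμ]
  exact le_antisymm ((Measure.restrict_apply_le _ _).trans h0.le) bot_le

end

end TakagiAux

/-- `Ω^L_fin` and `Ω^L_∞` are Borel, with `μ_S(Ω^L_fin) = 1`, `μ_S(Ω^L_∞) = 0`;
hence `τ^S(Ω^L_∞)` has Lebesgue measure zero. -/
theorem takagiSingularMeasure_OmegaLfin_OmegaLinf (μS : MeasureTheory.Measure ℝ)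
    (hμS : ∀ a b : ℝ, a ≤ b → μS (Set.Ioc a b) = ENNReal.ofReal (takagiS b - takagiS a)) :
    MeasurableSet OmegaLfin ∧ MeasurableSet OmegaLinf ∧
      μS OmegaLfin = 1 ∧ μS OmegaLinf = 0 ∧
      MeasureTheory.volume (takagiS '' OmegaLinf) = 0 := by
  rw [TakagiAux.H_one] at *
  have hinf := TakagiAux.mu_null μS hμS TakagiAux.vol_inf
  have hc := TakagiAux.mu_null μS hμS TakagiAux.vol_compl
  refine ⟨TakagiAux.meas_Omega.diff TakagiAux.meas_inf, TakagiAux.meas_inf, ?_, hinf,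
    TakagiAux.vol_inf⟩
  rw [OmegaLfin, measure_sdiff_null hinf, ← TakagiAux.mu_univ μS hμS]
  exact measure_congr (MeasureTheory.ae_eq_univ.2 hc)
end
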